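/- arXiv:1503.01175 — 3 statements merged into one kernel-verified Lean document; each statement's English description precedes it below -/
import Mathlib

section
/- For all x > 0 and 0 < a < b, the principal value integral over t in (0, ∞) of t·cos(a t) / (sin(b t) · (x² + t²)) dt equals (π/2) · cosh(a x) / sinh(b x). -/
open Real MeasureTheory Filter intervalIntegral

/-- `IsPVIntegral f p L` means the principal value of `∫₀^∞ f`, where `f` has
simple poles at the increasing sequence `p k`, equals `L`: for each sufficiently
small `ε > 0` one sums the integrals over the pole-free gaps (each pole shielded
by an `ε`-neighborhood), takes the limit over the number `N` of gaps, and this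
value tends to `L` as `ε → 0⁺`. -/
def IsPVIntegral (f : ℝ → ℝ) (p : ℕ → ℝ) (L : ℝ) : Prop :=
  ∃ ε₀ > (0:ℝ), ∃ F : ℝ → ℝ,
    (∀ ε ∈ Set.Ioo (0:ℝ) ε₀,
      Filter.Tendsto (fun N : ℕ =>
          (∫ t in (0:ℝ)..(p 0 - ε), f t) +
            ∑ k ∈ Finset.range N, ∫ t in (p k + ε)..(p (k + 1) - ε), f t)
        Filter.atTop (nhds (F ε))) ∧
    Filter.Tendsto F (nhdsWithin 0 (Set.Ioi 0)) (nhds L)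

lemma summable_one_div_one_add_int_sq : Summable fun k : ℤ => 1 / (1 + (k : ℝ) ^ 2) := by
  refine (Real.summable_one_div_int_pow.2 one_lt_two).of_norm_bounded_eventually ?_
  have : ({0}ᶜ : Set ℤ) ∈ Filter.cofinite := (Set.finite_singleton 0).compl_mem_cofinite
  filter_upwards [this] with k hk
  have hk' : (k : ℝ) ≠ 0 := by exact_mod_cast hk
  rw [Real.norm_of_nonneg (by positivity)]
  gcongr
  linarith

lemma one_add_int_sq_le_normSq {z : ℂ} (hre : |z.re| ≤ 1) (him : z.im ≠ 0) (k : ℤ) :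
    1 + (k : ℝ) ^ 2 ≤ (2 + 3 / z.im ^ 2) * ‖(k : ℂ) + z‖ ^ 2 := by
  have h1 : ‖(k : ℂ) + z‖ ^ 2 = (k + z.re) ^ 2 + z.im ^ 2 := by
    rw [← Complex.normSq_eq_norm_sq, Complex.normSq_apply]
    simp
    ring
  have h2 : z.re ^ 2 ≤ 1 := (sq_le_one_iff_abs_le_one _).2 hre
  have h3 : 0 ≤ 3 / z.im ^ 2 * ((k : ℝ) + z.re) ^ 2 := by positivity
  have h4 : 3 / z.im ^ 2 * z.im ^ 2 = 3 := by field_simp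
  rw [h1]
  nlinarith [sq_nonneg ((k : ℝ) + 2 * z.re), sq_nonneg z.im]

lemma int_add_ne_zero {z : ℂ} (him : z.im ≠ 0) (k : ℤ) : (k : ℂ) + z ≠ 0 := by
  intro h
  simpa [him] using congrArg Complex.im h

lemma norm_one_div_sub_one_div_le {z : ℂ} (hre : |z.re| ≤ 1) (him : z.im ≠ 0) (k : ℤ) :
    ‖1 / ((k : ℂ) + z) - 1 / (k - 1 + z)‖ ≤
      (2 + 3 / z.im ^ 2) * (1 / (1 + (k : ℝ) ^ 2) + 1 / (1 + ((k - 1 : ℤ) : ℝ) ^ 2)) := by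
  have h1 := int_add_ne_zero him k
  have h2 := int_add_ne_zero him (k - 1)
  have b1 := one_add_int_sq_le_normSq hre him k
  have b2 := one_add_int_sq_le_normSq hre him (k - 1)
  have e : 1 / ((k : ℂ) + z) - 1 / (k - 1 + z) = -(((k : ℂ) + z) * ((k - 1 : ℤ) + z))⁻¹ := by
    push_cast at h2 ⊢
    field_simp
    ring
  have n1 := norm_pos_iff.2 h1
  have n2 := norm_pos_iff.2 h2
  rw [e, norm_neg, norm_inv, norm_mul]
  set u := ‖(k : ℂ) + z‖
  set v := ‖((k - 1 : ℤ) : ℂ) + z‖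
  have c1 : 1 / u ^ 2 ≤ (2 + 3 / z.im ^ 2) * (1 / (1 + (k : ℝ) ^ 2)) := by
    rw [mul_one_div, div_le_div_iff₀ (by positivity) (by positivity)]
    linarith
  have c2 : 1 / v ^ 2 ≤ (2 + 3 / z.im ^ 2) * (1 / (1 + ((k - 1 : ℤ) : ℝ) ^ 2)) := by
    rw [mul_one_div, div_le_div_iff₀ (by positivity) (by positivity)]
    linarith
  have c3 : (u * v)⁻¹ ≤ 1 / u ^ 2 + 1 / v ^ 2 := by
    rw [mul_inv, one_div, one_div, ← inv_pow, ← inv_pow]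
    nlinarith [sq_nonneg (u⁻¹ - v⁻¹), sq_nonneg (u⁻¹ + v⁻¹), sq_nonneg u⁻¹, sq_nonneg v⁻¹]
  linarith

lemma summable_one_div_sub_bound (c : ℝ) : Summable fun k : ℤ =>
    c * (1 / (1 + (k : ℝ) ^ 2) + 1 / (1 + ((k - 1 : ℤ) : ℝ) ^ 2)) :=
  (summable_one_div_one_add_int_sq.add
    ((Equiv.subRight (1 : ℤ)).summable_iff.2 summable_one_div_one_add_int_sq)).mul_left c

lemma exp_neg_two_pi_I_mul_ne_one {z : ℂ} (him : z.im ≠ 0) :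
    1 - Complex.exp (-(2 * π * Complex.I * z)) ≠ 0 := by
  rw [sub_ne_zero, ne_comm, Ne, Complex.exp_eq_one_iff]
  rintro ⟨n, hn⟩
  have : z = -n := by
    have h : (2 * π * Complex.I : ℂ) ≠ 0 := Complex.two_pi_I_ne_zero
    apply mul_left_cancel₀ h
    linear_combination -hn
  exact him (by simp [this])

lemma fourierCoeffOn_one_sub_exp_mul_exp {z : ℂ} (him : z.im ≠ 0) (k : ℤ) :
    fourierCoeffOn (zero_lt_one' ℝ) (fun t : ℝ => (1 - Complex.exp (2 * π * Complex.I * t)) *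
      Complex.exp (-(2 * π * Complex.I * z * t))) k =
    (1 - Complex.exp (-(2 * π * Complex.I * z))) / (2 * π * Complex.I) *
      (1 / ((k : ℂ) + z) - 1 / (k - 1 + z)) := by
  have hI : (2 * π * Complex.I : ℂ) ≠ 0 := Complex.two_pi_I_ne_zero
  have h1 := int_add_ne_zero him k
  have h2 := int_add_ne_zero him (k - 1)
  push_cast at h2
  have key : ∀ m : ℤ, Complex.exp (-(2 * π * Complex.I * (m + z))) =
      Complex.exp (-(2 * π * Complex.I * z)) := fun m => by
    rw [← Complex.exp_periodic.int_mul m (-(2 * π * Complex.I * (m + z)))]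
    congr 1
    ring
  have k1 := key k
  have k2 := key (k - 1)
  push_cast at k2
  rw [fourierCoeffOn_eq_integral]
  have e : ∀ t : ℝ, fourier (-k) (t : AddCircle ((1 : ℝ) - 0)) •
      ((1 - Complex.exp (2 * π * Complex.I * t)) * Complex.exp (-(2 * π * Complex.I * z * t))) =
      Complex.exp (-(2 * π * Complex.I * (k + z)) * t) -
        Complex.exp (-(2 * π * Complex.I * (k - 1 + z)) * t) := fun t => by
    rw [fourier_coe_apply, smul_eq_mul, sub_mul, mul_sub, one_mul, ← Complex.exp_add,
      ← Complex.exp_add, ← Complex.exp_add]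
    push_cast
    congr 2 <;> ring
  simp_rw [e]
  rw [intervalIntegral.integral_sub, integral_exp_mul_complex, integral_exp_mul_complex]
  · simp only [Complex.ofReal_one, mul_one, Complex.ofReal_zero, mul_zero, Complex.exp_zero, k1, k2,
      sub_zero, div_one, one_smul]
    field_simp
    ring
  · exact neg_ne_zero.2 (mul_ne_zero hI h2)
  · exact neg_ne_zero.2 (mul_ne_zero hI h1)
  · exact Continuous.intervalIntegrable (by fun_prop) _ _
  · exact Continuous.intervalIntegrable (by fun_prop) _ _

lemma hasSum_zpow_mul_one_div_sub {z : ℂ} (hre : |z.re| ≤ 1) (him : z.im ≠ 0) {θ : ℝ}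
    (hθ : θ ∈ Set.Ico 0 1) :
    HasSum (fun k : ℤ => Complex.exp (2 * π * Complex.I * θ) ^ k *
        (1 / ((k : ℂ) + z) - 1 / (k - 1 + z)))
      ((1 - Complex.exp (2 * π * Complex.I * θ)) * (2 * π * Complex.I *
        Complex.exp (-(2 * π * Complex.I * z * θ)) /
          (1 - Complex.exp (-(2 * π * Complex.I * z))))) := by
  have hI : (2 * π * Complex.I : ℂ) ≠ 0 := Complex.two_pi_I_ne_zero
  have hE := exp_neg_two_pi_I_mul_ne_one him
  set w : ℝ → ℂ := fun t => (1 - Complex.exp (2 * π * Complex.I * t)) *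
      Complex.exp (-(2 * π * Complex.I * z * t)) with hw
  let W : C(AddCircle (1 : ℝ), ℂ) := ⟨AddCircle.liftIco 1 0 w,
    AddCircle.liftIco_zero_continuous (by simp [hw]) (by fun_prop)⟩
  have hc : ∀ k, fourierCoeff W k = (1 - Complex.exp (-(2 * π * Complex.I * z))) /
      (2 * π * Complex.I) * (1 / ((k : ℂ) + z) - 1 / (k - 1 + z)) := fun k => by
    rw [← fourierCoeffOn_one_sub_exp_mul_exp him, ContinuousMap.coe_mk, fourierCoeff_liftIco_eq]
    simp only [zero_add, hw]
  have hs : Summable (fourierCoeff W) := by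
    simp_rw [funext hc]
    exact (Summable.of_norm_bounded (summable_one_div_sub_bound _)
      (norm_one_div_sub_one_div_le hre him)).mul_left _
  have h := has_pointwise_sum_fourier_series_of_summable hs (θ : AddCircle (1 : ℝ))
  have hv : W θ = w θ := AddCircle.liftIco_zero_coe_apply (f := w) hθ
  rw [hv] at h
  simp_rw [hc] at h
  convert! h.mul_left (2 * π * Complex.I / (1 - Complex.exp (-(2 * π * Complex.I * z)))) using 1
  · ext k
    rw [fourier_coe_apply, ← Complex.exp_int_mul, smul_eq_mul]
    rw [show (2 * π * Complex.I * k * θ / (1 : ℝ) : ℂ) = k * (2 * π * Complex.I * θ) by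
      push_cast; ring]
    field_simp
  · simp only [hw]
    ring

lemma one_sub_mul_sum_zpow_div {z q : ℂ} (hq : q ≠ 0) (n : ℕ) :
    (1 - q) * ∑ j ∈ Finset.range n, (q ^ (j : ℤ) / (j + z) +
        q ^ (-((j : ℤ) + 1)) / (((-((j : ℤ) + 1) : ℤ) : ℂ) + z)) =
      ∑ j ∈ Finset.range n, (q ^ (j : ℤ) * (1 / (((j : ℤ) : ℂ) + z) - 1 / (((j : ℤ) : ℂ) - 1 + z)) +
        q ^ (-((j : ℤ) + 1)) * (1 / (((-((j : ℤ) + 1) : ℤ) : ℂ) + z) -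
          1 / (((-((j : ℤ) + 1) : ℤ) : ℂ) - 1 + z))) +
      (q ^ (-(n : ℤ)) / (((-(n : ℤ) - 1 : ℤ) : ℂ) + z) -
        q ^ (n : ℤ) / (((n - 1 : ℤ) : ℂ) + z)) := by
  induction n with
  | zero => simp
  | succ n ih =>
    rw [Finset.sum_range_succ, Finset.sum_range_succ, mul_add, ih]
    have e1 : q ^ (-(n : ℤ)) = q * q ^ (-((n : ℤ) + 1)) := by
      rw [← zpow_one_add₀ hq]
      congr 1
      ring
    have e2 : q ^ ((n : ℤ) + 1) = q * q ^ (n : ℤ) := by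
      rw [← zpow_one_add₀ hq, add_comm]
    push_cast
    rw [e2, e1, show (-((n : ℂ) + 1) + z) = -n - 1 + z by ring,
      show ((n : ℂ) + 1 - 1 + z) = n + z by ring]
    ring

lemma norm_zpow_of_norm_one {q : ℂ} (hq : ‖q‖ = 1) (k : ℤ) : ‖q ^ k‖ = 1 := by
  rw [norm_zpow, hq, one_zpow]

lemma norm_zpow_div_le {z q : ℂ} (him : z.im ≠ 0) (hq : ‖q‖ = 1) (k m : ℤ) :
    ‖q ^ k / (m + z)‖ ≤ |z.im|⁻¹ := by
  rw [norm_div, norm_zpow_of_norm_one hq, one_div]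
  have := abs_pos.2 him
  gcongr
  simpa using Complex.abs_im_le_norm ((m : ℂ) + z)

lemma tendsto_zpow_div_zero {z q : ℂ} (hq : ‖q‖ = 1) (u v : ℕ → ℤ)
    (hv : Tendsto (fun n => |(v n : ℝ)|) atTop atTop) :
    Tendsto (fun n => q ^ u n / (v n + z)) atTop (nhds 0) := by
  rw [tendsto_zero_iff_norm_tendsto_zero]
  simp_rw [norm_div, norm_zpow_of_norm_one hq, one_div]
  refine Tendsto.inv_tendsto_atTop (tendsto_atTop_mono (fun n => ?_)
    (tendsto_atTop_add_const_right _ (-‖z‖) hv))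
  have := norm_sub_norm_le (v n : ℂ) (-z)
  rw [sub_neg_eq_add, norm_neg, Complex.norm_intCast] at this
  linarith

lemma exp_two_pi_I_mul_ne_one {θ : ℝ} (hθ : θ ∈ Set.Ioo 0 1) :
    1 - Complex.exp (2 * π * Complex.I * θ) ≠ 0 := by
  rw [sub_ne_zero, ne_comm, Ne, Complex.exp_eq_one_iff]
  rintro ⟨n, hn⟩
  have h : (θ : ℂ) = n := by
    apply mul_left_cancel₀ Complex.two_pi_I_ne_zero
    linear_combination hn
  have h' : θ = n := by exact_mod_cast h
  have h1 := hθ.1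
  have h2 := hθ.2
  rw [h'] at h1 h2
  have h3 : 0 < n := by exact_mod_cast h1
  have h4 : n < 1 := by exact_mod_cast h2
  omega

lemma norm_exp_two_pi_I_mul (θ : ℝ) : ‖Complex.exp (2 * π * Complex.I * θ)‖ = 1 := by
  rw [show (2 * π * Complex.I * θ : ℂ) = ((2 * π * θ : ℝ) : ℂ) * Complex.I by push_cast; ring,
    Complex.norm_exp_ofReal_mul_I]

lemma tendsto_sum_zpow_div {z : ℂ} (hre : |z.re| ≤ 1) (him : z.im ≠ 0) {θ : ℝ}
    (hθ : θ ∈ Set.Ioo 0 1) :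
    Tendsto (fun n => ∑ j ∈ Finset.range n, (Complex.exp (2 * π * Complex.I * θ) ^ (j : ℤ) / (j + z) +
        Complex.exp (2 * π * Complex.I * θ) ^ (-((j : ℤ) + 1)) / (((-((j : ℤ) + 1) : ℤ) : ℂ) + z)))
      atTop (nhds (2 * π * Complex.I * Complex.exp (-(2 * π * Complex.I * z * θ)) /
          (1 - Complex.exp (-(2 * π * Complex.I * z))))) := by
  have h1 := exp_two_pi_I_mul_ne_one hθ
  have hn := norm_exp_two_pi_I_mul θ
  have hs := (hasSum_zpow_mul_one_div_sub hre him
    (Set.Ioo_subset_Ico_self hθ)).nat_add_neg_add_one.tendsto_sum_nat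
  have hq := Complex.exp_ne_zero (2 * π * Complex.I * θ)
  set q := Complex.exp (2 * π * Complex.I * θ)
  have b1 : Tendsto (fun n : ℕ => q ^ (-(n : ℤ)) / (((-(n : ℤ) - 1 : ℤ) : ℂ) + z)) atTop (nhds 0) := by
    refine tendsto_zpow_div_zero hn _ _ (tendsto_atTop_mono (fun n => ?_)
      tendsto_natCast_atTop_atTop)
    push_cast
    rw [le_abs]
    right
    linarith
  have b2 : Tendsto (fun n : ℕ => q ^ (n : ℤ) / (((n - 1 : ℤ) : ℂ) + z)) atTop (nhds 0) := by
    refine tendsto_zpow_div_zero hn _ _ (tendsto_atTop_mono (fun n => ?_)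
      (tendsto_atTop_add_const_right _ (-1) tendsto_natCast_atTop_atTop))
    push_cast
    exact le_abs_self _
  have h := (hs.add (b1.sub b2)).const_mul (1 - q)⁻¹
  rw [sub_zero, add_zero, inv_mul_cancel_left₀ h1] at h
  refine h.congr fun n => ?_
  rw [← one_sub_mul_sum_zpow_div hq, inv_mul_cancel_left₀ h1]

lemma exists_norm_sum_zpow_div_le {y : ℝ} (hy : y ≠ 0) {θ : ℝ} (hθ : θ ∈ Set.Ioo 0 1) :
    ∃ C, ∀ z : ℂ, |z.re| ≤ 1 → z.im = y → ∀ n,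
      ‖∑ j ∈ Finset.range n, (Complex.exp (2 * π * Complex.I * θ) ^ (j : ℤ) / (j + z) +
        Complex.exp (2 * π * Complex.I * θ) ^ (-((j : ℤ) + 1)) /
          (((-((j : ℤ) + 1) : ℤ) : ℂ) + z))‖ ≤ C := by
  have h1 := exp_two_pi_I_mul_ne_one hθ
  have hn := norm_exp_two_pi_I_mul θ
  have hq := Complex.exp_ne_zero (2 * π * Complex.I * θ)
  set q := Complex.exp (2 * π * Complex.I * θ)
  have hu := (summable_one_div_sub_bound (2 + 3 / y ^ 2)).nat_add_neg_add_one
  set u : ℤ → ℝ := fun k =>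
    (2 + 3 / y ^ 2) * (1 / (1 + (k : ℝ) ^ 2) + 1 / (1 + ((k - 1 : ℤ) : ℝ) ^ 2)) with hu_def
  have hu0 : ∀ k, 0 ≤ u k := fun k => by positivity
  refine ⟨‖1 - q‖⁻¹ * (∑' j : ℕ, (u j + u (-((j : ℤ) + 1))) + (|y|⁻¹ + |y|⁻¹)), fun z hre hz n => ?_⟩
  have him : z.im ≠ 0 := hz ▸ hy
  have bd : ∀ k : ℤ, ‖q ^ k * (1 / ((k : ℂ) + z) - 1 / (k - 1 + z))‖ ≤ u k := fun k => by
    rw [norm_mul, norm_zpow_of_norm_one hn, one_mul, hu_def, ← hz]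
    exact norm_one_div_sub_one_div_le hre him k
  rw [← inv_mul_cancel_left₀ h1 (∑ j ∈ Finset.range n, _), one_sub_mul_sum_zpow_div hq, norm_mul,
    norm_inv]
  gcongr
  refine (norm_add_le _ _).trans (add_le_add ?_ ?_)
  · refine (norm_sum_le _ _).trans ((Finset.sum_le_sum fun j _ => ?_).trans
      (hu.sum_le_tsum _ fun j _ => add_nonneg (hu0 _) (hu0 _)))
    exact (norm_add_le _ _).trans (add_le_add (bd _) (bd _))
  · rw [← hz]
    exact (norm_sub_le _ _).trans
      (add_le_add (norm_zpow_div_le him hn _ _) (norm_zpow_div_le him hn _ _))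

/-- The integrand `t cos (a t) / (sin (b t) (x² + t²))`. -/
noncomputable def cosSinRatio (a b x t : ℝ) : ℝ :=
  t * Real.cos (a * t) / (Real.sin (b * t) * (x ^ 2 + t ^ 2))

lemma cosSinRatio_eq_re {a b x s : ℝ} (hb : 0 < b) (hx : 0 < x) (k : ℤ) :
    cosSinRatio a b x (k * (π / b) + s) =
      (Real.sin (b * s))⁻¹ * (b / (2 * π) *
        (Complex.exp (a * s * Complex.I) *
            (Complex.exp (2 * π * Complex.I * ((1 / 2 + a / (2 * b) : ℝ) : ℂ)) ^ k /
              (k + b * (s + x * Complex.I) / π)) +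
          Complex.exp (-(a * s * Complex.I)) *
            (Complex.exp (2 * π * Complex.I * ((1 / 2 - a / (2 * b) : ℝ) : ℂ)) ^ k /
              (k + b * (s + x * Complex.I) / π)))).re := by
  have hbC : (b : ℂ) ≠ 0 := by exact_mod_cast hb.ne'
  have hpC : (π : ℂ) ≠ 0 := by exact_mod_cast Real.pi_ne_zero
  have hsin : Real.sin (b * (k * (π / b) + s)) = (-1) ^ k * Real.sin (b * s) := by
    rw [← Real.sin_add_int_mul_pi]
    congr 1
    field_simp
    ring
  have hneg : Complex.exp (k * (π * Complex.I)) = (-1) ^ k := by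
    rw [Complex.exp_int_mul, Complex.exp_pi_mul_I]
  set t : ℝ := k * (π / b) + s with ht
  have htC : (t : ℂ) = k * (π / b) + s := by rw [ht]; push_cast; ring
  have e1 : Complex.exp (a * s * Complex.I) *
      Complex.exp (2 * π * Complex.I * ((1 / 2 + a / (2 * b) : ℝ) : ℂ)) ^ k =
      (-1) ^ k * Complex.exp (a * t * Complex.I) := by
    rw [← hneg, ← Complex.exp_int_mul, ← Complex.exp_add, ← Complex.exp_add, htC]
    congr 1
    push_cast
    field_simp
    ring
  have e2 : Complex.exp (-(a * s * Complex.I)) *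
      Complex.exp (2 * π * Complex.I * ((1 / 2 - a / (2 * b) : ℝ) : ℂ)) ^ k =
      (-1) ^ k * Complex.exp (-(a * t) * Complex.I) := by
    rw [← hneg, ← Complex.exp_int_mul, ← Complex.exp_add, ← Complex.exp_add, htC]
    congr 1
    push_cast
    field_simp
    ring
  have e3 : (k : ℂ) + b * (s + x * Complex.I) / π = b / π * (t + x * Complex.I) := by
    rw [htC]
    field_simp
    ring
  have e4 : ((t : ℂ) + x * Complex.I) ≠ 0 := by
    intro h
    simpa [hx.ne'] using congrArg Complex.im h
  have e5 : (b / (2 * π) * (Complex.exp (a * s * Complex.I) *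
            (Complex.exp (2 * π * Complex.I * ((1 / 2 + a / (2 * b) : ℝ) : ℂ)) ^ k /
              (k + b * (s + x * Complex.I) / π)) +
          Complex.exp (-(a * s * Complex.I)) *
            (Complex.exp (2 * π * Complex.I * ((1 / 2 - a / (2 * b) : ℝ) : ℂ)) ^ k /
              (k + b * (s + x * Complex.I) / π))) : ℂ) =
      (((-1) ^ k * Real.cos (a * t) : ℝ) : ℂ) * ((t : ℂ) + x * Complex.I)⁻¹ := by
    rw [mul_div_assoc', mul_div_assoc', e1, e2, e3]
    push_cast
    rw [Complex.cos]
    field_simp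
  rw [cosSinRatio, e5, Complex.re_ofReal_mul, Complex.inv_re, Complex.normSq_add_mul_I, hsin]
  simp only [Complex.add_re, Complex.ofReal_re, Complex.mul_re, Complex.I_re, Complex.I_im,
    Complex.ofReal_im, mul_zero, zero_mul, sub_zero, add_zero]
  have h1 : ((-1 : ℝ) ^ k)⁻¹ = (-1) ^ k := by
    rw [← inv_zpow]
    norm_num
  rw [div_eq_mul_inv, mul_inv, mul_inv, h1, add_comm (x ^ 2)]
  ring

lemma sum_limit_eq {a b x s : ℝ} (hb : 0 < b) (hx : 0 < x) (hs : Real.sin (b * s) ≠ 0) :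
    (Real.sin (b * s))⁻¹ * (b / (2 * π) *
        (Complex.exp (a * s * Complex.I) * (2 * π * Complex.I *
          Complex.exp (-(2 * π * Complex.I * (b * (s + x * Complex.I) / π) *
            ((1 / 2 + a / (2 * b) : ℝ) : ℂ))) /
          (1 - Complex.exp (-(2 * π * Complex.I * (b * (s + x * Complex.I) / π))))) +
        Complex.exp (-(a * s * Complex.I)) * (2 * π * Complex.I *
          Complex.exp (-(2 * π * Complex.I * (b * (s + x * Complex.I) / π) *
            ((1 / 2 - a / (2 * b) : ℝ) : ℂ))) /
          (1 - Complex.exp (-(2 * π * Complex.I * (b * (s + x * Complex.I) / π))))))).re =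
      b * Real.cosh (a * x) * Real.cosh (b * x) /
        (Real.sin (b * s) ^ 2 + Real.sinh (b * x) ^ 2) := by
  have hbC : (b : ℂ) ≠ 0 := by exact_mod_cast hb.ne'
  have hpC : (π : ℂ) ≠ 0 := by exact_mod_cast Real.pi_ne_zero
  set w : ℂ := b * (s + x * Complex.I) with hw
  have e1 : Complex.exp (a * s * Complex.I) *
      Complex.exp (-(2 * π * Complex.I * (w / π) * ((1 / 2 + a / (2 * b) : ℝ) : ℂ))) =
      Complex.exp (-(w * Complex.I)) * Complex.exp (a * x) := by
    rw [← Complex.exp_add, ← Complex.exp_add, hw]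
    congr 1
    push_cast
    field_simp
    linear_combination (-(x * a : ℂ)) * Complex.I_sq
  have e2 : Complex.exp (-(a * s * Complex.I)) *
      Complex.exp (-(2 * π * Complex.I * (w / π) * ((1 / 2 - a / (2 * b) : ℝ) : ℂ))) =
      Complex.exp (-(w * Complex.I)) * Complex.exp (-(a * x)) := by
    rw [← Complex.exp_add, ← Complex.exp_add, hw]
    congr 1
    push_cast
    field_simp
    linear_combination ((x * a : ℂ)) * Complex.I_sq
  have e3 : Complex.exp (-(2 * π * Complex.I * (w / π))) =
      Complex.exp (-(w * Complex.I)) * Complex.exp (-(w * Complex.I)) := by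
    rw [← Complex.exp_add]
    congr 1
    field_simp
    ring
  have hden : 0 < Real.sin (b * s) ^ 2 + Real.sinh (b * x) ^ 2 := by positivity
  have hsw : Complex.sin w = (Real.sin (b * s) * Real.cosh (b * x) : ℝ) +
      (Real.cos (b * s) * Real.sinh (b * x) : ℝ) * Complex.I := by
    rw [hw, show (b * (s + x * Complex.I) : ℂ) = (b * s : ℂ) + (b * x : ℂ) * Complex.I by ring,
      Complex.sin_add_mul_I]
    push_cast
    ring
  have hnorm : Complex.normSq (Complex.sin w) =
      Real.sin (b * s) ^ 2 + Real.sinh (b * x) ^ 2 := by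
    rw [hsw, Complex.normSq_add_mul_I]
    have := Real.cosh_sq (b * x)
    rw [mul_pow, mul_pow, this]
    linear_combination Real.sinh (b * x) ^ 2 * Real.sin_sq_add_cos_sq (b * s)
  have hsw0 : Complex.sin w ≠ 0 := by
    rw [← Complex.normSq_pos, hnorm]
    exact hden
  have e4 : 1 - Complex.exp (-(w * Complex.I)) * Complex.exp (-(w * Complex.I)) =
      Complex.exp (-(w * Complex.I)) * (2 * Complex.I * Complex.sin w) := by
    have h : Complex.exp (-(w * Complex.I)) * Complex.exp (w * Complex.I) = 1 := by
      rw [← Complex.exp_add]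
      simp
    rw [Complex.sin, neg_mul]
    linear_combination (Complex.exp (-(w * Complex.I)) * (Complex.exp (w * Complex.I) -
      Complex.exp (-(w * Complex.I)))) * Complex.I_sq - h
  have hE := Complex.exp_ne_zero (-(w * Complex.I))
  have e5 : (b / (2 * π) * (Complex.exp (a * s * Complex.I) * (2 * π * Complex.I *
          Complex.exp (-(2 * π * Complex.I * (w / π) * ((1 / 2 + a / (2 * b) : ℝ) : ℂ))) /
          (1 - Complex.exp (-(2 * π * Complex.I * (w / π))))) +
        Complex.exp (-(a * s * Complex.I)) * (2 * π * Complex.I *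
          Complex.exp (-(2 * π * Complex.I * (w / π) * ((1 / 2 - a / (2 * b) : ℝ) : ℂ))) /
          (1 - Complex.exp (-(2 * π * Complex.I * (w / π)))))) : ℂ) =
      ((b * Real.cosh (a * x) : ℝ) : ℂ) * (Complex.sin w)⁻¹ := by
    have h : ∀ u v d : ℂ, u * (2 * π * Complex.I * v / d) = 2 * π * Complex.I * (u * v) / d :=
      fun u v d => by ring
    rw [h, h, e1, e2, e3, e4]
    push_cast
    rw [Complex.cosh]
    field_simp
  rw [e5, Complex.re_ofReal_mul, Complex.inv_re, hnorm, hsw]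
  simp only [Complex.add_re, Complex.ofReal_re, Complex.mul_re, Complex.I_re, Complex.I_im,
    Complex.ofReal_im, mul_zero, zero_mul, sub_zero, add_zero]
  field_simp

lemma theta_mem {a b : ℝ} (ha : 0 < a) (hab : a < b) :
    1 / 2 + a / (2 * b) ∈ Set.Ioo (0 : ℝ) 1 ∧ 1 / 2 - a / (2 * b) ∈ Set.Ioo (0 : ℝ) 1 := by
  have hb := ha.trans hab
  have h1 : 0 < a / (2 * b) := by positivity
  have h2 : a / (2 * b) < 1 / 2 := by
    rw [div_lt_div_iff₀ (by positivity) (by positivity)]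
    linarith
  refine ⟨⟨?_, ?_⟩, ?_, ?_⟩ <;> linarith

lemma abs_re_le_one {b x s : ℝ} (hb : 0 < b) (hs : s ∈ Set.Icc 0 (π / (2 * b))) :
    |((b * (s + x * Complex.I) / π : ℂ)).re| ≤ 1 ∧ ((b * (s + x * Complex.I) / π : ℂ)).im =
      b * x / π := by
  have e : (b * (s + x * Complex.I) / π : ℂ) =
      ((b * s / π : ℝ) : ℂ) + ((b * x / π : ℝ) : ℂ) * Complex.I := by
    push_cast
    ring
  have h := hs.2
  rw [le_div_iff₀ (by positivity)] at h
  rw [e]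
  simp only [Complex.add_re, Complex.ofReal_re, Complex.mul_re, Complex.I_re, Complex.I_im,
    Complex.ofReal_im, mul_zero, sub_zero, add_zero, Complex.add_im, Complex.mul_im,
    mul_one, zero_add, and_true]
  have h0 := hs.1
  rw [abs_of_nonneg (by positivity), div_le_one Real.pi_pos]
  nlinarith [Real.pi_pos]

/-- The symmetric sum over the translates by `k π / b`, with partial sums ranging
over `-n ≤ k < n`. -/
noncomputable def translateSum (a b x : ℝ) (n : ℕ) (s : ℝ) : ℝ :=
  ∑ j ∈ Finset.range n,
    (cosSinRatio a b x (((j : ℤ) : ℝ) * (π / b) + s) +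
      cosSinRatio a b x (((-((j : ℤ) + 1) : ℤ) : ℝ) * (π / b) + s))

lemma translateSum_eq {a b x s : ℝ} (hb : 0 < b) (hx : 0 < x) (n : ℕ) :
    translateSum a b x n s = (Real.sin (b * s))⁻¹ * (b / (2 * π) *
        (Complex.exp (a * s * Complex.I) * ∑ j ∈ Finset.range n,
            (Complex.exp (2 * π * Complex.I * ((1 / 2 + a / (2 * b) : ℝ) : ℂ)) ^ (j : ℤ) /
              (j + b * (s + x * Complex.I) / π) +
            Complex.exp (2 * π * Complex.I * ((1 / 2 + a / (2 * b) : ℝ) : ℂ)) ^ (-((j : ℤ) + 1)) /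
              (((-((j : ℤ) + 1) : ℤ) : ℂ) + b * (s + x * Complex.I) / π)) +
          Complex.exp (-(a * s * Complex.I)) * ∑ j ∈ Finset.range n,
            (Complex.exp (2 * π * Complex.I * ((1 / 2 - a / (2 * b) : ℝ) : ℂ)) ^ (j : ℤ) /
              (j + b * (s + x * Complex.I) / π) +
            Complex.exp (2 * π * Complex.I * ((1 / 2 - a / (2 * b) : ℝ) : ℂ)) ^ (-((j : ℤ) + 1)) /
              (((-((j : ℤ) + 1) : ℤ) : ℂ) + b * (s + x * Complex.I) / π)))).re := by
  rw [translateSum, Finset.mul_sum, Finset.mul_sum, ← Finset.sum_add_distrib, Finset.mul_sum,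
    Complex.re_sum, Finset.mul_sum]
  refine Finset.sum_congr rfl fun j _ => ?_
  rw [cosSinRatio_eq_re hb hx, cosSinRatio_eq_re hb hx, ← mul_add, ← Complex.add_re]
  congr 2
  simp only [Int.cast_natCast]
  ring

lemma tendsto_translateSum {a b x s : ℝ} (ha : 0 < a) (hab : a < b) (hx : 0 < x)
    (hs : s ∈ Set.Icc 0 (π / (2 * b))) (hsin : Real.sin (b * s) ≠ 0) :
    Tendsto (fun n => translateSum a b x n s) atTop
      (nhds (b * Real.cosh (a * x) * Real.cosh (b * x) /
        (Real.sin (b * s) ^ 2 + Real.sinh (b * x) ^ 2))) := by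
  have hb := ha.trans hab
  obtain ⟨hre, him⟩ := abs_re_le_one (x := x) hb hs
  have him' : ((b * (s + x * Complex.I) / π : ℂ)).im ≠ 0 := by rw [him]; positivity
  rw [← sum_limit_eq hb hx hsin]
  simp_rw [translateSum_eq hb hx]
  have h1 := tendsto_sum_zpow_div hre him' (theta_mem ha hab).1
  have h2 := tendsto_sum_zpow_div hre him' (theta_mem ha hab).2
  exact ((Complex.continuous_re.tendsto _).comp
    (((h1.const_mul _).add (h2.const_mul _)).const_mul _)).const_mul _

lemma exists_abs_translateSum_le {a b x : ℝ} (ha : 0 < a) (hab : a < b) (hx : 0 < x) :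
    ∃ C, 0 ≤ C ∧ ∀ s ∈ Set.Icc 0 (π / (2 * b)), ∀ n,
      |translateSum a b x n s| ≤ |Real.sin (b * s)|⁻¹ * C := by
  have hb := ha.trans hab
  have hy : b * x / π ≠ 0 := by positivity
  obtain ⟨C₁, h₁⟩ := exists_norm_sum_zpow_div_le hy (theta_mem ha hab).1
  obtain ⟨C₂, h₂⟩ := exists_norm_sum_zpow_div_le hy (theta_mem ha hab).2
  refine ⟨max 0 (‖(b / (2 * π) : ℂ)‖ * (C₁ + C₂)), le_max_left _ _, fun s hs n => ?_⟩
  obtain ⟨hre, him⟩ := abs_re_le_one (x := x) hb hs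
  rw [translateSum_eq hb hx, abs_mul, abs_inv]
  gcongr
  refine (Complex.abs_re_le_norm _).trans (le_trans ?_ (le_max_right _ _))
  rw [norm_mul]
  gcongr
  refine (norm_add_le _ _).trans (add_le_add ?_ ?_) <;> rw [norm_mul]
  · rw [show (a * s * Complex.I : ℂ) = ((a * s : ℝ) : ℂ) * Complex.I by push_cast; ring,
      Complex.norm_exp_ofReal_mul_I, one_mul]
    exact h₁ _ hre him n
  · rw [show (-(a * s * Complex.I) : ℂ) = ((-(a * s) : ℝ) : ℂ) * Complex.I by push_cast; ring,
      Complex.norm_exp_ofReal_mul_I, one_mul]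
    exact h₂ _ hre him n

lemma hasDerivAt_arctan_primitive {h c : ℝ} (hh : 0 < h) (hc : 0 < c) (hch : c ^ 2 = h ^ 2 + 1)
    (u : ℝ) :
    HasDerivAt (fun u => u + Real.arctan ((c - h) * (Real.sin u * Real.cos u) /
        (h * Real.cos u ^ 2 + c * Real.sin u ^ 2)))
      (h * c / (Real.sin u ^ 2 + h ^ 2)) u := by
  have hsc := Real.sin_sq_add_cos_sq u
  have hD : 0 < h * Real.cos u ^ 2 + c * Real.sin u ^ 2 := by
    rcases eq_or_ne (Real.sin u) 0 with h0 | h0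
    · rw [h0] at hsc ⊢
      have : Real.cos u ^ 2 = 1 := by linarith
      rw [this]
      linarith
    · positivity
  have d1 := (((Real.hasDerivAt_sin u).fun_mul (Real.hasDerivAt_cos u)).const_mul (c - h)).fun_div
    ((((Real.hasDerivAt_cos u).fun_pow 2).const_mul h).fun_add
      (((Real.hasDerivAt_sin u).fun_pow 2).const_mul c)) hD.ne'
  convert! (hasDerivAt_id' u).fun_add d1.arctan using 1
  have hE : (h * Real.cos u ^ 2 + c * Real.sin u ^ 2) ^ 2 +
      ((c - h) * (Real.sin u * Real.cos u)) ^ 2 = Real.sin u ^ 2 + h ^ 2 := by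
    linear_combination ((h ^ 2 * Real.cos u ^ 2 + c ^ 2 * Real.sin u ^ 2) + h ^ 2) * hsc +
      Real.sin u ^ 2 * hch
  have hP : 0 < Real.sin u ^ 2 + h ^ 2 := by positivity
  generalize Real.sin u = S at *
  generalize Real.cos u = C at *
  have h1 : 1 + ((c - h) * (S * C) / (h * C ^ 2 + c * S ^ 2)) ^ 2 =
      (S ^ 2 + h ^ 2) / (h * C ^ 2 + c * S ^ 2) ^ 2 := by
    rw [← hE]
    field_simp
  rw [h1]
  field_simp
  linear_combination hE - h * c * (S ^ 2 + C ^ 2 + 1) * hsc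

lemma integral_cosh_div {a b x : ℝ} (hb : 0 < b) (hx : 0 < x) :
    ∫ s in (0 : ℝ)..(π / (2 * b)), b * Real.cosh (a * x) * Real.cosh (b * x) /
        (Real.sin (b * s) ^ 2 + Real.sinh (b * x) ^ 2) =
      (π / 2) * Real.cosh (a * x) / Real.sinh (b * x) := by
  have hh : 0 < Real.sinh (b * x) := Real.sinh_pos_iff.2 (by positivity)
  have hd : ∀ s : ℝ, HasDerivAt (fun s => Real.cosh (a * x) / Real.sinh (b * x) *
      (b * s + Real.arctan ((Real.cosh (b * x) - Real.sinh (b * x)) *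
        (Real.sin (b * s) * Real.cos (b * s)) /
        (Real.sinh (b * x) * Real.cos (b * s) ^ 2 + Real.cosh (b * x) * Real.sin (b * s) ^ 2))))
      (b * Real.cosh (a * x) * Real.cosh (b * x) /
        (Real.sin (b * s) ^ 2 + Real.sinh (b * x) ^ 2)) s := fun s => by
    have h := ((hasDerivAt_arctan_primitive hh (Real.cosh_pos _) (by rw [Real.cosh_sq])
      (b * s)).comp s ((hasDerivAt_id' s).const_mul b)).const_mul
        (Real.cosh (a * x) / Real.sinh (b * x))
    convert! h using 1
    field_simp
  have hc : Continuous fun s => b * Real.cosh (a * x) * Real.cosh (b * x) /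
      (Real.sin (b * s) ^ 2 + Real.sinh (b * x) ^ 2) :=
    Continuous.div (by fun_prop) (by fun_prop) fun s => by positivity
  rw [intervalIntegral.integral_eq_sub_of_hasDerivAt (fun s _ => hd s) (hc.intervalIntegrable _ _)]
  have e : b * (π / (2 * b)) = π / 2 := by field_simp
  simp [e]
  ring

lemma cosSinRatio_neg (a b x t : ℝ) : cosSinRatio a b x (-t) = cosSinRatio a b x t := by
  simp only [cosSinRatio, mul_neg, Real.cos_neg, Real.sin_neg, neg_mul, neg_sq, neg_div_neg_eq]

lemma sin_mul_pos {b s : ℝ} (hb : 0 < b) (hs : s ∈ Set.Ioo 0 (π / b)) : 0 < Real.sin (b * s) := by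
  refine Real.sin_pos_of_pos_of_lt_pi (mul_pos hb hs.1) ?_
  have := (lt_div_iff₀ hb).1 hs.2
  linarith

lemma continuousOn_cosSinRatio_translate {a b x : ℝ} (hb : 0 < b) (hx : 0 < x) (k : ℤ) :
    ContinuousOn (fun s => cosSinRatio a b x (k * (π / b) + s)) (Set.Ioo 0 (π / b)) := by
  unfold cosSinRatio
  refine ContinuousOn.div (by fun_prop) (by fun_prop) fun s hs => ?_
  have h : Real.sin (b * (k * (π / b) + s)) = (-1) ^ k * Real.sin (b * s) := by
    rw [← Real.sin_add_int_mul_pi]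
    congr 1
    field_simp
    ring
  have h1 := (sin_mul_pos hb hs).ne'
  rw [h]
  have : (-1 : ℝ) ^ k ≠ 0 := zpow_ne_zero _ (by norm_num)
  positivity

lemma intervalIntegrable_cosSinRatio_translate {a b x u v : ℝ} (hb : 0 < b) (hx : 0 < x) (k : ℤ)
    (hu : u ∈ Set.Ioo 0 (π / b)) (hv : v ∈ Set.Ioo 0 (π / b)) :
    IntervalIntegrable (fun s => cosSinRatio a b x (k * (π / b) + s)) volume u v :=
  ((continuousOn_cosSinRatio_translate hb hx k).mono
    (Set.OrdConnected.uIcc_subset Set.ordConnected_Ioo hu hv)).intervalIntegrable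

lemma intervalIntegrable_cosSinRatio {a b x v : ℝ} (hb : 0 < b) (hx : 0 < x)
    (hv : v ∈ Set.Ioo 0 (π / b)) : IntervalIntegrable (cosSinRatio a b x) volume 0 v := by
  have hc : ContinuousOn (fun t => Real.cos (a * t) / (b * Real.sinc (b * t) * (x ^ 2 + t ^ 2)))
      (Set.uIcc 0 v) := by
    have := Real.continuous_sinc
    refine ContinuousOn.div (by fun_prop) (by fun_prop) fun t ht => ?_
    rw [Set.uIcc_of_le hv.1.le] at ht
    have : Real.sinc (b * t) ≠ 0 := by
      rcases ht.1.eq_or_lt with rfl | h0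
      · simp
      · rw [Real.sinc_of_ne_zero (by positivity)]
        have := sin_mul_pos hb ⟨h0, ht.2.trans_lt hv.2⟩
        positivity
    positivity
  refine hc.intervalIntegrable.congr fun t ht => ?_
  rw [Set.uIoc_of_le hv.1.le] at ht
  have h0 := ht.1
  have := sin_mul_pos hb ⟨h0, ht.2.trans_lt hv.2⟩
  simp only [cosSinRatio]
  rw [Real.sinc_of_ne_zero (by positivity)]
  field_simp

lemma integral_gap_eq {a b x ε : ℝ} (hb : 0 < b) (hx : 0 < x) (hε : ε ∈ Set.Ioo 0 (π / (2 * b)))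
    (j : ℕ) :
    ∫ t in (j * (π / b) + ε)..((j + 1) * (π / b) - ε), cosSinRatio a b x t =
      ∫ s in ε..(π / (2 * b)), (cosSinRatio a b x (((j : ℤ) : ℝ) * (π / b) + s) +
        cosSinRatio a b x (((-((j : ℤ) + 1) : ℤ) : ℝ) * (π / b) + s)) := by
  have hT : π / b = 2 * (π / (2 * b)) := by field_simp
  have hε' : ε ∈ Set.Ioo 0 (π / b) := ⟨hε.1, by linarith [hε.1, hε.2]⟩
  have hh : π / (2 * b) ∈ Set.Ioo 0 (π / b) := ⟨by positivity, by linarith [hε.1, hε.2]⟩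
  have hm : π / b - ε ∈ Set.Ioo 0 (π / b) := ⟨by linarith [hε'.2], by linarith [hε.1]⟩
  rw [intervalIntegral.integral_add (intervalIntegrable_cosSinRatio_translate hb hx _ hε' hh)
    (intervalIntegrable_cosSinRatio_translate hb hx _ hε' hh)]
  have e2 : ∀ s, cosSinRatio a b x (((-((j : ℤ) + 1) : ℤ) : ℝ) * (π / b) + s) =
      cosSinRatio a b x (((j : ℤ) : ℝ) * (π / b) + (π / b - s)) := fun s => by
    rw [← cosSinRatio_neg]
    congr 1
    push_cast
    ring
  simp_rw [e2]
  rw [intervalIntegral.integral_comp_sub_left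
      (fun s => cosSinRatio a b x (((j : ℤ) : ℝ) * (π / b) + s)) (π / b),
    show π / b - π / (2 * b) = π / (2 * b) by linarith,
    intervalIntegral.integral_add_adjacent_intervals
      (intervalIntegrable_cosSinRatio_translate hb hx _ hε' hh)
      (intervalIntegrable_cosSinRatio_translate hb hx _ hh hm),
    intervalIntegral.integral_comp_add_left]
  congr 1
  push_cast
  ring

lemma integral_add_sum_gaps_eq {a b x ε : ℝ} (hb : 0 < b) (hx : 0 < x)
    (hε : ε ∈ Set.Ioo 0 (π / (2 * b))) (N : ℕ) :
    (∫ t in (0 : ℝ)..(((0 : ℕ) + 1) * π / b - ε), cosSinRatio a b x t) +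
      ∑ k ∈ Finset.range N, ∫ t in (((k : ℝ) + 1) * π / b + ε)..((((k + 1 : ℕ) : ℝ) + 1) * π / b - ε),
        cosSinRatio a b x t =
      (∫ t in (0 : ℝ)..ε, cosSinRatio a b x t) +
        ∫ s in ε..(π / (2 * b)), translateSum a b x (N + 1) s := by
  have hT : π / b = 2 * (π / (2 * b)) := by field_simp
  have hε' : ε ∈ Set.Ioo 0 (π / b) := ⟨hε.1, by linarith [hε.1, hε.2]⟩
  have hh : π / (2 * b) ∈ Set.Ioo 0 (π / b) := ⟨by positivity, by linarith [hε.1, hε.2]⟩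
  have hm : π / b - ε ∈ Set.Ioo 0 (π / b) := ⟨by linarith [hε'.2], by linarith [hε.1]⟩
  simp only [translateSum]
  rw [intervalIntegral.integral_finsetSum fun j _ =>
    (intervalIntegrable_cosSinRatio_translate hb hx _ hε' hh).add
      (intervalIntegrable_cosSinRatio_translate hb hx _ hε' hh)]
  simp_rw [← integral_gap_eq hb hx hε]
  rw [Finset.sum_range_succ', ← add_assoc, add_right_comm]
  congr 1
  · have h0 := intervalIntegrable_cosSinRatio (a := a) hb hx hε'
    have h1 := intervalIntegrable_cosSinRatio (a := a) hb hx hm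
    simp only [Nat.cast_zero, zero_mul, zero_add, one_mul]
    rw [intervalIntegral.integral_add_adjacent_intervals h0 (h0.symm.trans h1)]
  · refine Finset.sum_congr rfl fun k _ => ?_
    push_cast
    rw [mul_div_assoc, mul_div_assoc]

theorem pv_t_cos_over_sin (a b x : ℝ) (hx : 0 < x) (ha : 0 < a) (hab : a < b) :
    IsPVIntegral (fun t => t * Real.cos (a * t) / (Real.sin (b * t) * (x ^ 2 + t ^ 2))) (fun k => ((k : ℝ) + 1) * Real.pi / b) ((Real.pi / 2) * Real.cosh (a * x) / Real.sinh (b * x)) := by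
  have hb := ha.trans hab
  have hT : π / b = 2 * (π / (2 * b)) := by field_simp
  have hh0 : 0 < π / (2 * b) := by positivity
  have hh : π / (2 * b) ∈ Set.Ioo 0 (π / b) := ⟨hh0, by linarith⟩
  set H : ℝ → ℝ := fun s => b * Real.cosh (a * x) * Real.cosh (b * x) /
    (Real.sin (b * s) ^ 2 + Real.sinh (b * x) ^ 2) with hH
  have hsinh : 0 < Real.sinh (b * x) := Real.sinh_pos_iff.2 (by positivity)
  have hHc : Continuous H := Continuous.div (by fun_prop) (by fun_prop) fun s => by positivity
  refine ⟨π / (2 * b), hh0, fun ε => (∫ t in (0 : ℝ)..ε, cosSinRatio a b x t) +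
    ∫ s in ε..(π / (2 * b)), H s, fun ε hε => ?_, ?_⟩
  · refine Tendsto.congr (fun N => (integral_add_sum_gaps_eq hb hx hε N).symm) ?_
    refine tendsto_const_nhds.add ?_
    obtain ⟨C, hC0, hC⟩ := exists_abs_translateSum_le ha hab hx
    have hsub : Set.uIcc ε (π / (2 * b)) ⊆ Set.Ioo 0 (π / b) :=
      Set.OrdConnected.uIcc_subset Set.ordConnected_Ioo ⟨hε.1, hε.2.trans hh.2⟩ hh
    have hIoc : ∀ s ∈ Set.uIoc ε (π / (2 * b)), s ∈ Set.Icc 0 (π / (2 * b)) ∧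
        Real.sin (b * s) ≠ 0 := fun s hs => by
      have h := hsub (Set.uIoc_subset_uIcc hs)
      rw [Set.uIoc_of_le hε.2.le] at hs
      exact ⟨⟨h.1.le, hs.2⟩, (sin_mul_pos hb h).ne'⟩
    refine intervalIntegral.tendsto_integral_filter_of_dominated_convergence
      (fun s => |Real.sin (b * s)|⁻¹ * C) (Eventually.of_forall fun N => ?_)
      (Eventually.of_forall fun N => ae_of_all _ fun s hs => ?_) ?_ (ae_of_all _ fun s hs => ?_)
    · refine (ContinuousOn.mono ?_
        (Set.uIoc_subset_uIcc.trans hsub)).aestronglyMeasurable measurableSet_uIoc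
      exact continuousOn_finsetSum _ fun j _ => (continuousOn_cosSinRatio_translate hb hx _).add
        (continuousOn_cosSinRatio_translate hb hx _)
    · exact hC s (hIoc s hs).1 _
    · refine ContinuousOn.intervalIntegrable ?_
      refine (ContinuousOn.inv₀ (by fun_prop) fun s hs => ?_).mul continuousOn_const
      exact (abs_pos.2 (sin_mul_pos hb (hsub hs)).ne').ne'
    · exact (tendsto_translateSum ha hab hx (hIoc s hs).1 (hIoc s hs).2).comp
        (tendsto_add_atTop_nat 1)
  · have hmem : Set.uIcc 0 (π / (2 * b)) ∈ nhdsWithin (0 : ℝ) (Set.Ioi 0) := by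
      rw [Set.uIcc_of_le hh0.le]
      exact Icc_mem_nhdsGT hh0
    have h1 : Tendsto (fun ε => ∫ t in (0 : ℝ)..ε, cosSinRatio a b x t)
        (nhdsWithin 0 (Set.Ioi 0)) (nhds 0) := by
      have h := (intervalIntegral.continuousOn_primitive_interval'
        (intervalIntegrable_cosSinRatio (a := a) hb hx hh) Set.left_mem_uIcc) 0 Set.left_mem_uIcc
      simpa using h.tendsto.mono_left (nhdsWithin_le_of_mem hmem)
    have h2 : Tendsto (fun ε => ∫ s in ε..(π / (2 * b)), H s) (nhdsWithin 0 (Set.Ioi 0))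
        (nhds (∫ s in (0 : ℝ)..(π / (2 * b)), H s)) := by
      have h : Continuous fun ε => ∫ s in ε..(π / (2 * b)), H s := by
        simp_rw [intervalIntegral.integral_symm (π / (2 * b))]
        exact (intervalIntegral.continuous_primitive (fun u v => hHc.intervalIntegrable u v) _).neg
      exact (h.tendsto 0).mono_left nhdsWithin_le_nhds
    rw [hH, integral_cosh_div hb hx] at h2
    simpa using h1.add h2
end

section
/- For all x > 0 and 0 < a < b, the principal value integral over t in (0, ∞) of cos(a t) / (cos(b t) · (x² + t²)) dt equals (π / (2x)) · cosh(a x) / cosh(b x). -/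
open Real MeasureTheory Filter intervalIntegral

/-- The two-sided exponential `u ↦ exp (-c|u|) * exp (-2πiσu)`. -/
noncomputable def twoSidedExp (c σ : ℝ) (u : ℝ) : ℂ :=
  Complex.exp (-c * |u| - 2 * π * σ * u * Complex.I)

lemma fourier_twoSidedExp {c : ℝ} (hc : 0 < c) (σ w : ℝ) :
    FourierTransform.fourier (twoSidedExp c σ) w =
      ((2 * c / (c ^ 2 + 4 * π ^ 2 * (w + σ) ^ 2) : ℝ) : ℂ) := by
  rw [Real.fourier_real_eq_integral_exp_smul]
  set z : ℂ := 2 * π * (w + σ) * Complex.I with hz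
  have hpos : Set.EqOn (fun v : ℝ => Complex.exp (↑(-2 * π * v * w) * Complex.I) • twoSidedExp c σ v)
      (fun v : ℝ => Complex.exp ((-c - z) * v)) (Set.Ioi 0) := by
    intro v hv
    simp only [twoSidedExp, abs_of_pos (Set.mem_Ioi.mp hv), smul_eq_mul, ← Complex.exp_add, hz]
    push_cast
    ring_nf
  have hneg : Set.EqOn (fun v : ℝ => Complex.exp (↑(-2 * π * v * w) * Complex.I) • twoSidedExp c σ v)
      (fun v : ℝ => Complex.exp ((c - z) * v)) (Set.Iic 0) := by
    intro v hv
    simp only [twoSidedExp, abs_of_nonpos (Set.mem_Iic.mp hv), smul_eq_mul, ← Complex.exp_add, hz]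
    push_cast
    ring_nf
  have hre₁ : (-c - z).re < 0 := by simp [hz, hc]
  have hre₂ : 0 < (c - z).re := by simp [hz, hc]
  rw [← intervalIntegral.integral_Iic_add_Ioi (b := 0)
      ((integrableOn_exp_mul_complex_Iic hre₂ 0).congr_fun hneg.symm measurableSet_Iic)
      ((integrableOn_exp_mul_complex_Ioi hre₁ 0).congr_fun hpos.symm measurableSet_Ioi),
    setIntegral_congr_fun measurableSet_Iic hneg, setIntegral_congr_fun measurableSet_Ioi hpos,
    integral_exp_mul_complex_Ioi hre₁, integral_exp_mul_complex_Iic hre₂]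
  have h₁ : (-c - z) ≠ 0 := fun h => by simp [h] at hre₁
  have h₂ : (c - z) ≠ 0 := fun h => by simp [h] at hre₂
  have h₃ : (c : ℂ) ^ 2 + 4 * π ^ 2 * (w + σ) ^ 2 = -((-c - z) * (c - z)) := by
    rw [hz]; ring_nf; rw [Complex.I_sq]; ring
  push_cast
  rw [h₃]
  simp only [mul_zero, Complex.exp_zero]
  field_simp
  ring

lemma continuous_twoSidedExp (c σ : ℝ) : Continuous (twoSidedExp c σ) := by
  unfold twoSidedExp
  fun_prop

lemma norm_twoSidedExp (c σ u : ℝ) : ‖twoSidedExp c σ u‖ = exp (-c * |u|) := by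
  simp [twoSidedExp, Complex.norm_exp]

lemma isBigO_twoSidedExp {c : ℝ} (hc : 0 < c) (σ : ℝ) :
    twoSidedExp c σ =O[cocompact ℝ] fun u : ℝ => |u| ^ (-2 : ℝ) := by
  have h := (isLittleO_exp_neg_mul_rpow_atTop hc (-2)).isBigO.comp_tendsto
    (tendsto_norm_cocompact_atTop (E := ℝ))
  refine (Asymptotics.isBigO_of_le _ fun u => ?_).trans h
  simp [norm_twoSidedExp]

/-- A shifted integer lattice is comparable with the unshifted one. -/
lemma inv_one_add_sq_le {v : ℝ} (hv : v ^ 2 ≤ 1) (k : ℝ) :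
    (1 + (k + v) ^ 2)⁻¹ ≤ 3 * (1 + k ^ 2)⁻¹ := by
  rw [← div_eq_mul_inv, inv_eq_one_div, div_le_div_iff₀ (by positivity) (by positivity)]
  nlinarith [sq_nonneg (k + 2 * v)]

lemma summable_int_inv_one_add_sq : Summable fun k : ℤ => (1 + (k : ℝ) ^ 2)⁻¹ := by
  refine summable_of_isBigO (Real.summable_abs_int_rpow one_lt_two) ?_
  refine Asymptotics.IsBigO.of_bound 1 ?_
  filter_upwards [(Set.finite_singleton (0 : ℤ)).compl_mem_cofinite] with k hk
  have hk : (k : ℝ) ≠ 0 := by simpa using hk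
  have : 0 < (k : ℝ) ^ 2 := by positivity
  rw [Real.rpow_neg (abs_nonneg _), Real.rpow_two, sq_abs, one_mul,
    Real.norm_of_nonneg (by positivity), Real.norm_of_nonneg (by positivity)]
  gcongr
  linarith

lemma hasSum_twoSidedExp {c : ℝ} (hc : 0 < c) (σ : ℝ) {y : ℝ} (hy : y ∈ Set.Icc (0 : ℝ) 1) :
    HasSum (fun n : ℤ => twoSidedExp c σ (y + n))
      (Complex.exp (-(c + 2 * π * σ * Complex.I) * y) /
          (1 - Complex.exp (-(c + 2 * π * σ * Complex.I))) +
        Complex.exp (-(c - 2 * π * σ * Complex.I) * (1 - y)) /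
          (1 - Complex.exp (-(c - 2 * π * σ * Complex.I)))) := by
  simp only [div_eq_mul_inv]
  refine HasSum.of_nat_of_neg_add_one ?_ ?_
  · have hlt : ‖Complex.exp (-(c + 2 * π * σ * Complex.I))‖ < 1 := by
      simpa [Complex.norm_exp] using hc
    convert! (hasSum_geometric_of_norm_lt_one hlt).mul_left _ using 2 with n
    · have : 0 ≤ y + n := add_nonneg hy.1 n.cast_nonneg
      simp only [twoSidedExp, Int.cast_natCast, abs_of_nonneg this, ← Complex.exp_nat_mul,
        ← Complex.exp_add]
      push_cast
      ring_nf
  · have hlt : ‖Complex.exp (-(c - 2 * π * σ * Complex.I))‖ < 1 := by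
      simpa [Complex.norm_exp] using hc
    convert! (hasSum_geometric_of_norm_lt_one hlt).mul_left _ using 2 with n
    · have : y + ((-((n : ℤ) + 1) : ℤ) : ℝ) ≤ 0 := by
        push_cast
        linarith [hy.2, (Nat.cast_nonneg n : (0 : ℝ) ≤ n)]
      simp only [twoSidedExp, abs_of_nonpos this, ← Complex.exp_nat_mul, ← Complex.exp_add]
      push_cast
      ring_nf

lemma hasSum_exp_div_sq_add_sq {c σ y : ℝ} (hc : 0 < c) (hσ : σ ^ 2 ≤ 1)
    (hy : y ∈ Set.Icc (0 : ℝ) 1) :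
    HasSum (fun k : ℤ => ((2 * c / (c ^ 2 + 4 * π ^ 2 * (k + σ) ^ 2) : ℝ) : ℂ) *
        Complex.exp (2 * π * (k + σ) * y * Complex.I))
      (Complex.exp (-c * y) / (1 - Complex.exp (-(c + 2 * π * σ * Complex.I))) +
        Complex.exp (-c * (1 - y)) * Complex.exp (2 * π * σ * Complex.I) /
          (1 - Complex.exp (-(c - 2 * π * σ * Complex.I)))) := by
  have hsum : Summable fun k : ℤ => FourierTransform.fourier (twoSidedExp c σ) (k : ℝ) := by
    refine Summable.of_norm_bounded
      ((summable_int_inv_one_add_sq.mul_left 3).mul_left (2 * c * ((c ^ 2)⁻¹ + (4 * π ^ 2)⁻¹)))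
      fun k => ?_
    rw [fourier_twoSidedExp hc, Complex.norm_real, Real.norm_of_nonneg (by positivity),
      div_eq_mul_inv, mul_assoc (2 * c)]
    refine mul_le_mul_of_nonneg_left ?_ (by positivity)
    refine le_trans ?_ (mul_le_mul_of_nonneg_left (inv_one_add_sq_le hσ k) (by positivity))
    rw [← div_eq_mul_inv, inv_eq_one_div, div_le_div_iff₀ (by positivity) (by positivity)]
    have : ((c ^ 2)⁻¹ + (4 * π ^ 2)⁻¹) * (c ^ 2 + 4 * π ^ 2 * (k + σ) ^ 2) =
        1 + (k + σ) ^ 2 + (4 * π ^ 2)⁻¹ * c ^ 2 + (c ^ 2)⁻¹ * (4 * π ^ 2 * (k + σ) ^ 2) := by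
      field_simp
      ring
    rw [this]
    have h₁ : 0 ≤ (4 * π ^ 2)⁻¹ * c ^ 2 := by positivity
    have h₂ : 0 ≤ (c ^ 2)⁻¹ * (4 * π ^ 2 * (k + σ) ^ 2) := by positivity
    linarith
  have hpoisson := Real.tsum_eq_tsum_fourier_of_rpow_decay_of_summable
    (continuous_twoSidedExp c σ) one_lt_two (isBigO_twoSidedExp hc σ) hsum y
  rw [(hasSum_twoSidedExp hc σ hy).tsum_eq] at hpoisson
  have hsum' : Summable fun k : ℤ => FourierTransform.fourier (twoSidedExp c σ) (k : ℝ) *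
      fourier k (y : UnitAddCircle) := by
    refine hsum.norm.of_norm_bounded fun k => ?_
    rw [norm_mul, fourier_apply, Circle.norm_coe, mul_one]
  have h := hsum'.hasSum
  rw [← hpoisson] at h
  convert! h.mul_left (Complex.exp (2 * π * σ * y * Complex.I)) using 1
  · ext k
    rw [fourier_twoSidedExp hc, fourier_coe_apply, mul_left_comm, ← Complex.exp_add]
    congr 2
    push_cast
    ring
  · rw [mul_add, ← mul_div_assoc, ← mul_div_assoc, ← Complex.exp_add, ← Complex.exp_add,
      ← Complex.exp_add]
    ring_nf

lemma re_exp_quotients_eq (A B θ : ℝ) (hB : 0 < B) :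
    (Complex.I * Complex.exp (-θ * Complex.I) *
      (Complex.exp (-(B + A)) / (1 + Complex.exp (-(2 * B + 2 * θ * Complex.I))) -
        Complex.exp (-(B - A)) * Complex.exp (2 * θ * Complex.I) /
          (1 + Complex.exp (-(2 * B - 2 * θ * Complex.I))))).re =
      sin θ * (cosh A * sinh B / (sinh B ^ 2 + cos θ ^ 2)) := by
  have hS : 0 < sinh B := Real.sinh_pos_iff.mpr hB
  have hD : 0 < sinh B ^ 2 + cos θ ^ 2 := by positivity
  set z : ℂ := B + θ * Complex.I with hz
  set w : ℂ := B - θ * Complex.I with hw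
  have hcz : Complex.cosh z = (cosh B * cos θ : ℝ) + (sinh B * sin θ : ℝ) * Complex.I := by
    rw [hz, Complex.cosh_add, Complex.cosh_mul_I, Complex.sinh_mul_I]; push_cast; ring
  have hcw : Complex.cosh w = (cosh B * cos θ : ℝ) - (sinh B * sin θ : ℝ) * Complex.I := by
    rw [hw, Complex.cosh_sub, Complex.cosh_mul_I, Complex.sinh_mul_I]; push_cast; ring
  have hprod : Complex.cosh z * Complex.cosh w = (sinh B ^ 2 + cos θ ^ 2 : ℝ) := by
    rw [hcz, hcw]
    have : (cosh B * cos θ) ^ 2 + (sinh B * sin θ) ^ 2 = sinh B ^ 2 + cos θ ^ 2 := by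
      rw [mul_pow, mul_pow, Real.cosh_sq, Real.sin_sq]; ring
    rw [← this]
    push_cast
    ring_nf
    rw [Complex.I_sq]
    ring
  have hprod0 : Complex.cosh z * Complex.cosh w ≠ 0 := by
    rw [hprod]; exact_mod_cast hD.ne'
  have hz0 := left_ne_zero_of_mul hprod0
  have hw0 := right_ne_zero_of_mul hprod0
  have h₁ : 1 + Complex.exp (-(2 * B + 2 * θ * Complex.I)) =
      2 * Complex.cosh z * Complex.exp (-z) := by
    rw [Complex.cosh, mul_div_cancel₀ _ two_ne_zero, add_mul, ← Complex.exp_add,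
      ← Complex.exp_add, add_neg_cancel, Complex.exp_zero, hz]
    ring_nf
  have h₂ : 1 + Complex.exp (-(2 * B - 2 * θ * Complex.I)) =
      2 * Complex.cosh w * Complex.exp (-w) := by
    rw [Complex.cosh, mul_div_cancel₀ _ two_ne_zero, add_mul, ← Complex.exp_add,
      ← Complex.exp_add, add_neg_cancel, Complex.exp_zero, hw]
    ring_nf
  have h₃ : Complex.exp (-θ * Complex.I) * Complex.exp (-(B + A)) =
      Complex.exp (-A) * Complex.exp (-z) := by
    rw [← Complex.exp_add, ← Complex.exp_add, hz]; ring_nf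
  have h₄ : Complex.exp (-θ * Complex.I) *
      (Complex.exp (-(B - A)) * Complex.exp (2 * θ * Complex.I)) =
      Complex.exp A * Complex.exp (-w) := by
    rw [← Complex.exp_add, ← Complex.exp_add, ← Complex.exp_add, hw]; ring_nf
  have key : Complex.I * Complex.exp (-θ * Complex.I) *
      (Complex.exp (-(B + A)) / (1 + Complex.exp (-(2 * B + 2 * θ * Complex.I))) -
        Complex.exp (-(B - A)) * Complex.exp (2 * θ * Complex.I) /
          (1 + Complex.exp (-(2 * B - 2 * θ * Complex.I)))) =
      Complex.I * (Complex.exp (-A) * Complex.cosh w - Complex.exp A * Complex.cosh z) /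
        (2 * (sinh B ^ 2 + cos θ ^ 2) : ℝ) := by
    rw [mul_assoc, mul_sub (Complex.exp (-θ * Complex.I)), ← mul_div_assoc, ← mul_div_assoc, h₃,
      h₄, h₁, h₂, mul_div_mul_right _ _ (Complex.exp_ne_zero _),
      mul_div_mul_right _ _ (Complex.exp_ne_zero _), Complex.ofReal_mul, ← hprod]
    push_cast
    field_simp
  rw [key, Complex.div_ofReal_re, hcz, hcw, Real.cosh_eq A]
  simp only [← Complex.ofReal_neg, ← Complex.ofReal_exp]
  simp only [Complex.mul_re, Complex.I_re, Complex.I_im, Complex.sub_im, Complex.mul_im,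
    Complex.add_im, Complex.sub_re, Complex.add_re, Complex.ofReal_re, Complex.ofReal_im]
  field_simp
  ring

/-- The integrand of the principal value integral. -/
noncomputable def cosQuotient (a b x t : ℝ) : ℝ := cos (a * t) / (cos (b * t) * (x ^ 2 + t ^ 2))

lemma cosQuotient_neg (a b x t : ℝ) : cosQuotient a b x (-t) = cosQuotient a b x t := by
  simp [cosQuotient]

/-- The zeros of `cos (b * t)`, indexed by the integers. -/
noncomputable def cosZero (b : ℝ) (k : ℤ) : ℝ := (2 * (k : ℝ) + 1) * π / (2 * b)

lemma cosZero_neg_add_one (b : ℝ) (k : ℤ) : cosZero b (-(k + 1)) = -cosZero b k := by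
  simp only [cosZero]
  push_cast
  ring

lemma cosZero_add_one (b : ℝ) (k : ℤ) : cosZero b (k + 1) = cosZero b k + 2 * (π / (2 * b)) := by
  simp only [cosZero]
  push_cast
  ring

lemma mul_cosZero_add {b : ℝ} (hb : b ≠ 0) (k : ℤ) (s : ℝ) :
    b * (cosZero b k + s) = b * s + k * π + π / 2 := by
  simp only [cosZero]
  field_simp
  ring

lemma cos_mul_cosZero_add {b : ℝ} (hb : b ≠ 0) (k : ℤ) (s : ℝ) :
    cos (b * (cosZero b k + s)) = -((-1) ^ k * sin (b * s)) := by
  rw [mul_cosZero_add hb, Real.cos_add_pi_div_two, Real.sin_add_int_mul_pi]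

lemma abs_cos_mul_cosZero_add {b : ℝ} (hb : b ≠ 0) (k : ℤ) (s : ℝ) :
    |cos (b * (cosZero b k + s))| = |sin (b * s)| := by
  rw [cos_mul_cosZero_add hb, abs_neg, abs_mul, abs_zpow, abs_neg, abs_one, one_zpow, one_mul]

lemma hasSum_cosQuotient {a b x s : ℝ} (hx : 0 < x) (ha : 0 < a) (hab : a < b) (hs : 0 < s)
    (hs' : s ≤ π / (2 * b)) :
    HasSum (fun k : ℤ => cosQuotient a b x (cosZero b k + s))
      (b / x * (cosh (a * x) * sinh (b * x) / (sinh (b * x) ^ 2 + cos (b * s) ^ 2))) := by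
  have hb : 0 < b := ha.trans hab
  have hbs : 0 < b * s := by positivity
  have hbs' : b * s ≤ π / 2 := by
    calc b * s ≤ b * (π / (2 * b)) := by gcongr
      _ = π / 2 := by field_simp
  have hsin : 0 < sin (b * s) := Real.sin_pos_of_pos_of_lt_pi hbs (by linarith [pi_pos])
  set σ : ℝ := 1 / 2 + b * s / π with hσ
  set y : ℝ := 1 / 2 + a / (2 * b) with hy
  have hσ0 : 0 ≤ σ := by positivity
  have hσ1 : σ ≤ 1 := by
    have : b * s / π ≤ 1 / 2 := by rw [div_le_iff₀ pi_pos]; linarith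
    linarith
  have hy1 : y ≤ 1 := by
    have : a / (2 * b) ≤ 1 / 2 := by rw [div_le_iff₀ (by positivity)]; linarith
    linarith
  have h := hasSum_exp_div_sq_add_sq (c := 2 * b * x) (by positivity)
    (pow_le_one₀ hσ0 hσ1 : σ ^ 2 ≤ 1) (y := y) ⟨by positivity, hy1⟩
  have hre := Complex.hasSum_re
    (h.mul_left (Complex.I * Complex.exp (-(b * s : ℝ) * Complex.I)))
  have h2σ : 2 * π * (σ : ℂ) * Complex.I = π * Complex.I + 2 * (b * s : ℝ) * Complex.I := by
    have : 2 * π * σ = π + 2 * (b * s) := by rw [hσ]; field_simp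
    rw [← add_mul]
    exact_mod_cast congrArg (fun r : ℝ => (r : ℂ) * Complex.I) this
  have hval : Complex.exp (-(2 * b * x : ℝ) * y) /
        (1 - Complex.exp (-((2 * b * x : ℝ) + 2 * π * σ * Complex.I))) +
      Complex.exp (-(2 * b * x : ℝ) * (1 - y)) * Complex.exp (2 * π * σ * Complex.I) /
        (1 - Complex.exp (-((2 * b * x : ℝ) - 2 * π * σ * Complex.I))) =
      Complex.exp (-((b * x : ℝ) + (a * x : ℝ))) /
          (1 + Complex.exp (-(2 * (b * x : ℝ) + 2 * (b * s : ℝ) * Complex.I))) -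
        Complex.exp (-((b * x : ℝ) - (a * x : ℝ))) * Complex.exp (2 * (b * s : ℝ) * Complex.I) /
          (1 + Complex.exp (-(2 * (b * x : ℝ) - 2 * (b * s : ℝ) * Complex.I))) := by
    have e₁ : -((2 * b * x : ℝ) : ℂ) * y = -((b * x : ℝ) + (a * x : ℝ)) := by
      have : -(2 * b * x) * y = -(b * x + a * x) := by rw [hy]; field_simp
      exact_mod_cast congrArg (fun r : ℝ => (r : ℂ)) this
    have e₂ : -((2 * b * x : ℝ) : ℂ) * (1 - y) = -((b * x : ℝ) - (a * x : ℝ)) := by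
      have : -(2 * b * x) * (1 - y) = -(b * x - a * x) := by rw [hy]; field_simp; ring
      exact_mod_cast congrArg (fun r : ℝ => (r : ℂ)) this
    have e₃ : -(((2 * b * x : ℝ) : ℂ) + (π * Complex.I + 2 * (b * s : ℝ) * Complex.I)) =
        -(2 * (b * x : ℝ) + 2 * (b * s : ℝ) * Complex.I) - π * Complex.I := by
      push_cast; ring
    have e₄ : -(((2 * b * x : ℝ) : ℂ) - (π * Complex.I + 2 * (b * s : ℝ) * Complex.I)) =
        -(2 * (b * x : ℝ) - 2 * (b * s : ℝ) * Complex.I) + π * Complex.I := by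
      push_cast; ring
    rw [h2σ, e₁, e₂, e₃, e₄, Complex.exp_sub_pi_mul_I, Complex.exp_add_pi_mul_I,
      add_comm (π * Complex.I), Complex.exp_add_pi_mul_I]
    ring
  rw [hval, re_exp_quotients_eq _ _ _ (by positivity)] at hre
  convert! hre.mul_left (b / (x * sin (b * s))) using 1
  · ext k
    set t := cosZero b k + s with ht
    have htσ : (k : ℝ) + σ = b / π * t := by
      rw [ht, cosZero, hσ]; field_simp; ring
    have hfac : 2 * (2 * b * x) / ((2 * b * x) ^ 2 + 4 * π ^ 2 * (k + σ) ^ 2) =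
        x / b / (x ^ 2 + t ^ 2) := by
      rw [htσ]
      field_simp
      ring
    have hphase : Complex.I * Complex.exp (-(b * s : ℝ) * Complex.I) *
        (((2 * (2 * b * x) / ((2 * b * x) ^ 2 + 4 * π ^ 2 * (k + σ) ^ 2) : ℝ) : ℂ) *
          Complex.exp (2 * π * (k + σ) * y * Complex.I)) =
        ((x / b / (x ^ 2 + t ^ 2) : ℝ) : ℂ) *
          (Complex.I * Complex.exp ((a * t + k * π + π / 2 : ℝ) * Complex.I)) := by
      have : -(b * s) + 2 * π * (k + σ) * y = a * t + k * π + π / 2 := by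
        rw [htσ]
        have := mul_cosZero_add hb.ne' k s
        rw [← ht] at this
        rw [hy]
        field_simp
        linarith
      rw [hfac, ← this, mul_left_comm, mul_assoc Complex.I, ← Complex.exp_add]
      push_cast
      ring_nf
    rw [hphase, Complex.re_ofReal_mul, Complex.I_mul_re, Complex.exp_ofReal_mul_I_im,
      Real.sin_add_pi_div_two, Real.cos_add_int_mul_pi, cosQuotient, ht, cos_mul_cosZero_add hb.ne',
      ← ht]
    have hpow : ((-1 : ℝ) ^ k) * (-1) ^ k = 1 := by
      rw [← mul_zpow]; simp
    have hk : ((-1 : ℝ) ^ k) ≠ 0 := left_ne_zero_of_mul_eq_one hpow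
    have : 0 < x ^ 2 + t ^ 2 := by positivity
    field_simp
    linear_combination cos (a * t) * hpow
  · field_simp

lemma integral_inv_sq_sinh_add_cos_sq {B : ℝ} (hB : 0 < B) :
    ∫ θ in (0 : ℝ)..π / 2, (sinh B ^ 2 + cos θ ^ 2)⁻¹ = π / (2 * (sinh B * cosh B)) := by
  have hS : 0 < sinh B := Real.sinh_pos_iff.mpr hB
  have hC : 0 < cosh B := Real.cosh_pos B
  have hcont : Continuous fun θ : ℝ => (sinh B ^ 2 + cos θ ^ 2)⁻¹ :=
    Continuous.inv₀ (by fun_prop) fun θ => by positivity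
  rw [integral_eq_sub_of_hasDerivAt_of_tendsto
    (f := fun θ => (sinh B * cosh B)⁻¹ * arctan (sinh B / cosh B * tan θ)) (fa := 0)
    (fb := (sinh B * cosh B)⁻¹ * (π / 2)) (by positivity) ?_ (hcont.intervalIntegrable _ _) ?_ ?_]
  · field_simp
    ring
  · intro θ hθ
    have hcos : 0 < cos θ := Real.cos_pos_of_mem_Ioo ⟨by linarith [hθ.1, pi_pos], hθ.2⟩
    refine ((((Real.hasDerivAt_tan hcos.ne').const_mul (sinh B / cosh B)).arctan).const_mul
      (sinh B * cosh B)⁻¹).congr_deriv ?_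
    have hsq := Real.cosh_sq B
    have htrig := Real.sin_sq θ
    rw [Real.tan_eq_sin_div_cos]
    field_simp
    rw [hsq, htrig]
    ring
  · have : ContinuousAt (fun θ => (sinh B * cosh B)⁻¹ * arctan (sinh B / cosh B * tan θ)) 0 := by
      have : ContinuousAt tan 0 := Real.continuousAt_tan.mpr (by simp)
      fun_prop
    simpa using this.tendsto.mono_left nhdsWithin_le_nhds
  · refine Tendsto.const_mul _ ?_
    exact (tendsto_arctan_atTop.mono_right nhdsWithin_le_nhds).comp
      (tendsto_tan_pi_div_two.const_mul_atTop (by positivity))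

lemma integral_residual {a b x : ℝ} (hx : 0 < x) (hb : 0 < b) :
    ∫ s in (0 : ℝ)..π / (2 * b),
        b / x * (cosh (a * x) * sinh (b * x) / (sinh (b * x) ^ 2 + cos (b * s) ^ 2)) =
      π / (2 * x) * cosh (a * x) / cosh (b * x) := by
  have hS : 0 < sinh (b * x) := Real.sinh_pos_iff.mpr (by positivity)
  have hC : 0 < cosh (b * x) := Real.cosh_pos _
  simp only [div_eq_mul_inv _ (sinh (b * x) ^ 2 + _), intervalIntegral.integral_const_mul]
  rw [intervalIntegral.integral_comp_mul_left (fun θ => (sinh (b * x) ^ 2 + cos θ ^ 2)⁻¹) hb.ne',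
    mul_zero, show b * (π / (2 * b)) = π / 2 by field_simp,
    integral_inv_sq_sinh_add_cos_sq (by positivity), smul_eq_mul]
  field_simp

lemma continuousOn_cosQuotient {b x : ℝ} (a : ℝ) (hx : 0 < x) (hb : 0 < b) (k : ℤ) {ε : ℝ}
    (hε : 0 < ε) :
    ContinuousOn (cosQuotient a b x)
      (Set.Icc (cosZero b k + ε) (cosZero b k + (2 * (π / (2 * b)) - ε))) := by
  refine ContinuousOn.div (by fun_prop) (by fun_prop) fun t ht => ?_
  have hcos : cos (b * t) ≠ 0 := by
    rw [← abs_pos, show t = cosZero b k + (t - cosZero b k) by ring,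
      abs_cos_mul_cosZero_add hb.ne', abs_pos]
    refine (Real.sin_pos_of_pos_of_lt_pi (mul_pos hb (by linarith [ht.1])) ?_).ne'
    calc b * (t - cosZero b k) < b * (2 * (π / (2 * b))) := by
          gcongr
          linarith [ht.2]
      _ = π := by field_simp
  positivity

lemma hasSum_integral_cosQuotient {a b x ε : ℝ} (hx : 0 < x) (ha : 0 < a) (hab : a < b)
    (hε : 0 < ε) (hε' : ε ≤ π / (2 * b)) :
    HasSum (fun k : ℤ => ∫ s in ε..π / (2 * b), cosQuotient a b x (cosZero b k + s))
      (∫ s in ε..π / (2 * b),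
        b / x * (cosh (a * x) * sinh (b * x) / (sinh (b * x) ^ 2 + cos (b * s) ^ 2))) := by
  have hb : 0 < b := ha.trans hab
  have hbh : b * (π / (2 * b)) = π / 2 := by field_simp
  have hsinε : 0 < sin (b * ε) := Real.sin_pos_of_pos_of_lt_pi (by positivity)
    ((mul_le_mul_of_nonneg_left hε' hb.le).trans_lt (by rw [hbh]; linarith [pi_pos]))
  set M : ℝ := (x ^ 2)⁻¹ + (b / π) ^ 2 with hM
  have hsumm : Summable fun k : ℤ => (sin (b * ε))⁻¹ * (M * (3 * (1 + (k : ℝ) ^ 2)⁻¹)) :=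
    ((summable_int_inv_one_add_sq.mul_left 3).mul_left M).mul_left _
  refine intervalIntegral.hasSum_integral_of_dominated_convergence
    (fun k _ => (sin (b * ε))⁻¹ * (M * (3 * (1 + (k : ℝ) ^ 2)⁻¹))) (fun k => ?_)
    (fun k => .of_forall fun s hs => ?_) (.of_forall fun _ _ => hsumm)
    intervalIntegrable_const (.of_forall fun s hs => ?_)
  · refine Measurable.aestronglyMeasurable ?_
    unfold cosQuotient
    fun_prop
  · rw [Set.uIoc_of_le hε', Set.mem_Ioc] at hs
    set t := cosZero b k + s with ht
    set v : ℝ := 1 / 2 + b * s / π with hv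
    have hbs : b * s ≤ π / 2 := hbh ▸ mul_le_mul_of_nonneg_left hs.2 hb.le
    have hs0 : 0 < s := hε.trans hs.1
    have hv0 : 0 ≤ v := by positivity
    have hv1 : v ≤ 1 := by
      have : b * s / π ≤ 1 / 2 := by rw [div_le_iff₀ pi_pos]; linarith
      linarith
    have htv : b / π * t = (k : ℝ) + v := by
      rw [ht, cosZero, hv]; field_simp; ring
    have hmono : sin (b * ε) ≤ sin (b * s) :=
      Real.sin_le_sin_of_le_of_le_pi_div_two (by nlinarith [pi_pos]) hbs (by gcongr; exact hs.1.le)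
    have hden : (x ^ 2 + t ^ 2)⁻¹ ≤ M * (1 + ((k : ℝ) + v) ^ 2)⁻¹ := by
      rw [← div_eq_mul_inv, inv_eq_one_div, div_le_div_iff₀ (by positivity) (by positivity),
        ← htv, hM]
      have : ((x ^ 2)⁻¹ + (b / π) ^ 2) * (x ^ 2 + t ^ 2) =
          1 + (b / π * t) ^ 2 + ((x ^ 2)⁻¹ * t ^ 2 + (b / π * x) ^ 2) := by
        field_simp
        ring
      rw [this, one_mul]
      exact le_add_of_nonneg_right (by positivity)
    rw [cosQuotient, div_eq_mul_inv, mul_inv, norm_mul, norm_mul, norm_inv, Real.norm_eq_abs,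
      Real.norm_eq_abs, abs_cos_mul_cosZero_add hb.ne', abs_of_pos (hsinε.trans_le hmono),
      Real.norm_of_nonneg (by positivity)]
    calc |cos (a * t)| * ((sin (b * s))⁻¹ * (x ^ 2 + t ^ 2)⁻¹)
        ≤ 1 * ((sin (b * ε))⁻¹ * (M * (3 * (1 + (k : ℝ) ^ 2)⁻¹))) := by
          refine mul_le_mul (abs_cos_le_one _) (mul_le_mul (by gcongr) (hden.trans ?_)
            (by positivity) (by positivity))
            (mul_nonneg (inv_nonneg.mpr (hsinε.trans_le hmono).le) (by positivity)) zero_le_one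
          exact mul_le_mul_of_nonneg_left (inv_one_add_sq_le (pow_le_one₀ hv0 hv1) k)
            (by positivity)
      _ = _ := one_mul _
  · rw [Set.uIoc_of_le hε', Set.mem_Ioc] at hs
    exact hasSum_cosQuotient hx ha hab (hε.trans hs.1) hs.2

lemma integral_gaps_eq {a b x ε : ℝ} (hx : 0 < x) (hb : 0 < b) (hε : 0 < ε)
    (hε' : ε ≤ π / (2 * b)) (N : ℕ) :
    let u : ℤ → ℝ := fun k => ∫ s in ε..π / (2 * b), cosQuotient a b x (cosZero b k + s)
    (∫ t in (0 : ℝ)..(cosZero b 0 - ε), cosQuotient a b x t) +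
        ∑ k ∈ Finset.range N,
          ∫ t in (cosZero b k + ε)..(cosZero b (k + 1) - ε), cosQuotient a b x t =
      ∑ k ∈ Finset.range N, (u k + u (-(k + 1))) + u (-(N + 1)) := by
  intro u
  set h : ℝ := π / (2 * b) with hh
  have hleft (k : ℤ) : u (-(k + 1)) =
      ∫ t in (cosZero b k - h)..(cosZero b k - ε), cosQuotient a b x t := by
    rw [← intervalIntegral.integral_comp_sub_left]
    refine intervalIntegral.integral_congr fun s _ => ?_
    rw [cosZero_neg_add_one, ← cosQuotient_neg, neg_add, neg_neg, sub_eq_add_neg]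
  have hright (k : ℤ) : u k =
      ∫ t in (cosZero b k + ε)..(cosZero b k + h), cosQuotient a b x t :=
    intervalIntegral.integral_comp_add_left _ _
  have hgap (k : ℤ) : ∫ t in (cosZero b k + ε)..(cosZero b (k + 1) - ε), cosQuotient a b x t =
      u k + u (-(k + 1 + 1)) := by
    have hcont := continuousOn_cosQuotient a hx hb k hε
    rw [hleft, hright, cosZero_add_one, ← hh] at *
    rw [show cosZero b k + 2 * h - h = cosZero b k + h by ring,
      intervalIntegral.integral_add_adjacent_intervals]
    · refine (hcont.mono ?_).intervalIntegrable
      rw [Set.uIcc_of_le (by linarith)]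
      exact Set.Icc_subset_Icc le_rfl (by linarith)
    · refine (hcont.mono ?_).intervalIntegrable
      rw [Set.uIcc_of_le (by linarith)]
      exact Set.Icc_subset_Icc (by linarith) (by linarith)
  induction N with
  | zero =>
    have h0 := hleft 0
    have hz : cosZero b 0 - h = 0 := by simp [cosZero, hh]
    rw [hz] at h0
    simpa using h0.symm
  | succ n ih =>
    rw [Finset.sum_range_succ, Finset.sum_range_succ, ← add_assoc, ih, hgap]
    push_cast
    ring

theorem pv_cos_over_cos (a b x : ℝ) (hx : 0 < x) (ha : 0 < a) (hab : a < b) :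
    IsPVIntegral (fun t => Real.cos (a * t) / (Real.cos (b * t) * (x ^ 2 + t ^ 2))) (fun k => (2 * (k : ℝ) + 1) * Real.pi / (2 * b)) ((Real.pi / (2 * x)) * Real.cosh (a * x) / Real.cosh (b * x)) := by
  have hb : 0 < b := ha.trans hab
  have hh : 0 < π / (2 * b) := by positivity
  have hS : 0 < sinh (b * x) := Real.sinh_pos_iff.mpr (by positivity)
  refine ⟨π / (2 * b), hh, fun ε => ∫ s in ε..π / (2 * b),
    b / x * (cosh (a * x) * sinh (b * x) / (sinh (b * x) ^ 2 + cos (b * s) ^ 2)),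
    fun ε hε => ?_, ?_⟩
  · have hsum := hasSum_integral_cosQuotient hx ha hab hε.1 hε.2.le
    have hpairs := hsum.nat_add_neg_add_one.tendsto_sum_nat
    have hinj : Function.Injective fun N : ℕ => -((N : ℤ) + 1) := fun m n hmn => by
      simpa using hmn
    have hlast := (Nat.cofinite_eq_atTop ▸ hsum.summable.tendsto_cofinite_zero.comp
      hinj.tendsto_cofinite :)
    have htotal := hpairs.add hlast
    rw [add_zero] at htotal
    refine htotal.congr fun N => ?_
    have hgaps := integral_gaps_eq (a := a) hx hb hε.1 hε.2.le N
    dsimp only at hgaps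
    simpa [cosZero, cosQuotient] using hgaps.symm
  · have hcont : Continuous fun s : ℝ =>
        b / x * (cosh (a * x) * sinh (b * x) / (sinh (b * x) ^ 2 + cos (b * s) ^ 2)) :=
      continuous_const.mul (continuous_const.div (by fun_prop) fun s => by positivity)
    rw [← integral_residual hx hb]
    have hprim : Continuous fun ε : ℝ => ∫ s in ε..π / (2 * b),
        b / x * (cosh (a * x) * sinh (b * x) / (sinh (b * x) ^ 2 + cos (b * s) ^ 2)) := by
      simp only [intervalIntegral.integral_symm (π / (2 * b))]
      exact (intervalIntegral.continuous_primitive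
        (fun _ _ => hcont.intervalIntegrable _ _) _).neg
    exact (hprim.tendsto 0).mono_left nhdsWithin_le_nhds
end

section
/- For all b > 0 and x > 0, the principal value integral over t in (0, ∞) of tan(b t)·t / (x² + t²) dt equals π / (e^{2 b x} + 1). -/
open Real MeasureTheory Filter intervalIntegral

lemma re_cot_add_mul_I (u v : ℝ) (hv : v ≠ 0) :
    (Complex.cot (u + v * Complex.I)).re =
      Real.sin u * Real.cos u / (Real.sinh v ^ 2 + Real.sin u ^ 2) := by
  have hpos : 0 < Real.sinh v ^ 2 + Real.sin u ^ 2 :=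
    add_pos_of_pos_of_nonneg (sq_pos_of_ne_zero (Real.sinh_ne_zero.2 hv)) (sq_nonneg _)
  have hnorm : Complex.normSq (Complex.sin (u + v * Complex.I)) =
      Real.sinh v ^ 2 + Real.sin u ^ 2 := by
    rw [Complex.sin_add_mul_I, ← Complex.ofReal_sin, ← Complex.ofReal_cos, ← Complex.ofReal_sinh,
      ← Complex.ofReal_cosh, ← Complex.ofReal_mul, ← Complex.ofReal_mul,
      Complex.normSq_add_mul_I, mul_pow, mul_pow, Real.cosh_sq, Real.cos_sq']
    ring
  rw [Complex.cot, Complex.div_re, hnorm, Complex.sin_add_mul_I, Complex.cos_add_mul_I,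
    ← Complex.ofReal_sin, ← Complex.ofReal_cos, ← Complex.ofReal_sinh, ← Complex.ofReal_cosh]
  simp only [← Complex.ofReal_mul, Complex.sub_re, Complex.add_re, Complex.sub_im, Complex.add_im,
    Complex.ofReal_re, Complex.ofReal_im, Complex.re_ofReal_mul, Complex.im_ofReal_mul,
    Complex.I_re, Complex.I_im]
  rw [← add_div]
  congr 1
  linear_combination (Real.sin u * Real.cos u) * Real.cosh_sq v

lemma re_one_div_add_mul_I (t x : ℝ) :
    (1 / ((t : ℂ) + x * Complex.I)).re = t / (x ^ 2 + t ^ 2) := by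
  simp [Complex.normSq_apply]
  ring_nf

lemma tendsto_sum_div_sq_add_sq {b x : ℝ} (hb : 0 < b) (hx : 0 < x) (s : ℝ) :
    Tendsto (fun N : ℕ => ∑ k ∈ Finset.range N,
      ((s - (k + 1) * π / b) / (x ^ 2 + (s - (k + 1) * π / b) ^ 2) +
        (s + (k + 1) * π / b) / (x ^ 2 + (s + (k + 1) * π / b) ^ 2))) atTop
      (nhds (b * (Real.sin (b * s) * Real.cos (b * s) /
        (Real.sinh (b * x) ^ 2 + Real.sin (b * s) ^ 2)) - s / (x ^ 2 + s ^ 2))) := by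
  have hb' : (b : ℂ) ≠ 0 := by exact_mod_cast hb.ne'
  set z : ℂ := (b / π : ℝ) * (s + x * Complex.I) with hz
  have him : ∀ t : ℝ, (t : ℂ) + x * Complex.I ≠ 0 := fun t h => by
    have := congrArg Complex.im h
    simp [hx.ne'] at this
  have hscale : ∀ t : ℝ, ((b / π : ℝ) : ℂ) * (1 / (z + (t * b / π : ℝ))) =
      1 / (((s + t : ℝ) : ℂ) + x * Complex.I) := fun t => by
    have h : z + (t * b / π : ℝ) = (b / π : ℝ) * (((s + t : ℝ) : ℂ) + x * Complex.I) := by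
      rw [hz]; push_cast; field_simp; ring
    rw [h]
    have := him (s + t)
    push_cast at this ⊢
    field_simp
  have hmem : z ∈ Complex.integerComplement := by
    rintro ⟨n, hn⟩
    have := congrArg Complex.im hn
    rw [hz, Complex.im_ofReal_mul] at this
    simp [hx.ne', hb.ne', pi_ne_zero] at this
  have key := (Complex.continuous_re.tendsto _).comp
    ((tendsto_logDeriv_euler_cot_sub hmem).const_mul ((b / π : ℝ) : ℂ))
  convert key using 2
  · simp only [Function.comp, Finset.mul_sum, Complex.re_sum]
    refine Finset.sum_congr rfl fun k _ => ?_
    have h1 := hscale (-((k + 1) * π / b))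
    have h2 := hscale ((k + 1) * π / b)
    rw [show (-((k + 1) * π / b)) * b / π = -((k : ℝ) + 1) by field_simp] at h1
    rw [show ((k + 1) * π / b) * b / π = ((k : ℝ) + 1) by field_simp] at h2
    rw [cotTerm, mul_add]
    have e1 := re_one_div_add_mul_I (s - (k + 1) * π / b) x
    have e2 := re_one_div_add_mul_I (s + (k + 1) * π / b) x
    rw [sub_eq_add_neg, ← h1] at e1
    rw [← h2] at e2
    rw [sub_eq_add_neg s, ← e1, ← e2, Complex.add_re]
    push_cast
    rw [sub_eq_add_neg z]
  · have h0 := hscale 0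
    have hcot : (π : ℂ) * z = ((b * s : ℝ) : ℂ) + (b * x : ℝ) * Complex.I := by
      rw [hz]; push_cast; field_simp
    rw [hcot, mul_sub, Complex.sub_re, ← mul_assoc, ← Complex.ofReal_mul,
      div_mul_cancel₀ _ pi_ne_zero, Complex.re_ofReal_mul, re_cot_add_mul_I _ _ (by positivity)]
    simp only [zero_mul, zero_div, Complex.ofReal_zero, add_zero] at h0
    rw [h0, re_one_div_add_mul_I]

lemma abs_div_sq_add_sq_pair_le {x s c : ℝ} (hx : 0 < x) (hs : 0 ≤ s) (hc : 2 * s ≤ c) (hc0 : 0 < c) :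
    |(s - c) / (x ^ 2 + (s - c) ^ 2) + (s + c) / (x ^ 2 + (s + c) ^ 2)| ≤ 8 * s / c ^ 2 := by
  have e : (s - c) / (x ^ 2 + (s - c) ^ 2) + (s + c) / (x ^ 2 + (s + c) ^ 2) =
      2 * s * (x ^ 2 + s ^ 2 - c ^ 2) / ((x ^ 2 + (s - c) ^ 2) * (x ^ 2 + (s + c) ^ 2)) := by
    have : 0 < x ^ 2 + (s - c) ^ 2 := by positivity
    have : 0 < x ^ 2 + (s + c) ^ 2 := by positivity
    field_simp
    ring
  have h1 : |x ^ 2 + s ^ 2 - c ^ 2| ≤ x ^ 2 + c ^ 2 := by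
    rw [abs_le]; constructor <;> nlinarith
  have h2 : x ^ 2 + c ^ 2 ≤ x ^ 2 + (s + c) ^ 2 := by nlinarith
  have h3 : c ^ 2 / 4 ≤ x ^ 2 + (s - c) ^ 2 := by nlinarith
  have h4 : 0 < x ^ 2 + c ^ 2 := by positivity
  rw [e, abs_div, abs_mul, abs_of_nonneg (by positivity : 0 ≤ 2 * s),
    abs_of_nonneg (by positivity :
      0 ≤ (x ^ 2 + (s - c) ^ 2) * (x ^ 2 + (s + c) ^ 2))]
  calc _ ≤ 2 * s * (x ^ 2 + c ^ 2) / (c ^ 2 / 4 * (x ^ 2 + c ^ 2)) := by gcongr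
    _ = _ := by field_simp; ring

lemma cos_mul_pos {b a s : ℝ} (hb : 0 < b) (ha : b * a < π / 2) (hs : |s| ≤ a) :
    0 < Real.cos (b * s) := by
  rw [abs_le] at hs
  apply Real.cos_pos_of_mem_Ioo
  constructor <;> nlinarith

lemma continuousOn_tan_mul {b a : ℝ} (hb : 0 < b) (ha : b * a < π / 2) :
    ContinuousOn (fun s => Real.tan (b * s)) (Set.Icc (-a) a) := by
  intro s hs
  refine ContinuousAt.continuousWithinAt ?_
  exact ContinuousAt.comp' (f := fun s => b * s)
    (Real.continuousAt_tan.2 (cos_mul_pos hb ha (abs_le.2 hs)).ne') (by fun_prop)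

lemma continuous_div_sq_add_sq {x : ℝ} (hx : 0 < x) (c : ℝ) :
    Continuous fun s : ℝ => (s + c) / (x ^ 2 + (s + c) ^ 2) :=
  Continuous.div (by fun_prop) (by fun_prop) fun s => by positivity

lemma integral_gap {b x a : ℝ} (hb : 0 < b) (hx : 0 < x) (ha0 : 0 ≤ a) (ha : b * a < π / 2)
    (k : ℕ) :
    ∫ t in ((k + 1) * π / b - a)..((k + 1) * π / b + a), Real.tan (b * t) * t / (x ^ 2 + t ^ 2) =
      ∫ s in (0 : ℝ)..a, Real.tan (b * s) *
        ((s - (k + 1) * π / b) / (x ^ 2 + (s - (k + 1) * π / b) ^ 2) +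
          (s + (k + 1) * π / b) / (x ^ 2 + (s + (k + 1) * π / b) ^ 2)) := by
  set c : ℝ := (k + 1) * π / b with hc
  have htan : ∀ s, Real.tan (b * (s + c)) = Real.tan (b * s) := fun s => by
    rw [show b * (s + c) = b * s + (k + 1 : ℕ) * π by rw [hc]; push_cast; field_simp,
      Real.tan_add_nat_mul_pi]
  have hcont : ∀ d : ℝ, ContinuousOn
      (fun s => Real.tan (b * s) * ((s + d) / (x ^ 2 + (s + d) ^ 2))) (Set.Icc (-a) a) :=
    fun d => (continuousOn_tan_mul hb ha).mul (continuous_div_sq_add_sq hx d).continuousOn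
  have hint : ∀ d p q : ℝ, p ∈ Set.Icc (-a) a → q ∈ Set.Icc (-a) a → IntervalIntegrable
      (fun s => Real.tan (b * s) * ((s + d) / (x ^ 2 + (s + d) ^ 2))) volume p q :=
    fun d p q hp hq =>
      ((hcont d).mono (Set.uIcc_subset_Icc hp hq)).intervalIntegrable
  have hm : -a ∈ Set.Icc (-a) a := ⟨le_rfl, by linarith⟩
  have h0 : (0 : ℝ) ∈ Set.Icc (-a) a := ⟨by linarith, ha0⟩
  have hp : a ∈ Set.Icc (-a) a := ⟨by linarith, le_rfl⟩
  rw [show c - a = -a + c by ring, show c + a = a + c by ring,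
    ← intervalIntegral.integral_comp_add_right]
  simp only [htan, mul_div_assoc]
  rw [← intervalIntegral.integral_add_adjacent_intervals (hint c _ _ hm h0) (hint c _ _ h0 hp)]
  have hneg : ∫ s in (-a)..0, Real.tan (b * s) * ((s + c) / (x ^ 2 + (s + c) ^ 2)) =
      ∫ s in (0 : ℝ)..a, Real.tan (b * s) * ((s + -c) / (x ^ 2 + (s + -c) ^ 2)) := by
    rw [← neg_zero, ← intervalIntegral.integral_comp_neg, neg_zero]
    refine intervalIntegral.integral_congr fun s _ => ?_
    simp only [mul_neg, Real.tan_neg]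
    rw [show (-s + c) ^ 2 = (s + -c) ^ 2 by ring]
    ring
  rw [hneg, ← intervalIntegral.integral_add (hint (-c) _ _ h0 hp) (hint c _ _ h0 hp)]
  refine intervalIntegral.integral_congr fun s _ => ?_
  simp only [sub_eq_add_neg]
  ring

lemma integral_limit_kernel {b x a : ℝ} (hb : 0 < b) (hx : 0 < x) (ha0 : 0 ≤ a)
    (ha : b * a < π / 2) :
    ∫ s in (0 : ℝ)..a, Real.tan (b * s) * (b * (Real.sin (b * s) * Real.cos (b * s) /
        (Real.sinh (b * x) ^ 2 + Real.sin (b * s) ^ 2))) =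
      b * a - Real.tanh (b * x) * Real.arctan (Real.tan (b * a) / Real.tanh (b * x)) := by
  have hsh : 0 < Real.sinh (b * x) := Real.sinh_pos_iff.2 (by positivity)
  have hch : 0 < Real.cosh (b * x) := Real.cosh_pos _
  have hden : ∀ s, 0 < Real.sinh (b * x) ^ 2 + Real.sin (b * s) ^ 2 := fun s => by positivity
  rw [intervalIntegral.integral_eq_sub_of_hasDerivAt (f := fun s =>
    b * s - Real.tanh (b * x) * Real.arctan (Real.tan (b * s) / Real.tanh (b * x)))]
  · simp
  · intro s hs
    rw [Set.uIcc_of_le ha0] at hs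
    have hcos := cos_mul_pos hb ha (abs_le.2 ⟨by linarith [hs.1], hs.2⟩)
    have hlin : HasDerivAt (fun s : ℝ => b * s) b s := by
      simpa using (hasDerivAt_id s).const_mul b
    have h1 := (((Real.hasDerivAt_tan hcos.ne').comp s hlin).div_const
      (Real.tanh (b * x))).arctan.const_mul (Real.tanh (b * x))
    convert! hlin.sub h1 using 1
    simp only [Function.comp]
    rw [Real.tan_eq_sin_div_cos, Real.tanh_eq_sinh_div_cosh]
    have e1 := Real.sin_sq_add_cos_sq (b * s)
    have e2 := Real.cosh_sq (b * x)
    have := hden s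
    set S := Real.sin (b * s)
    set C := Real.cos (b * s)
    set p := Real.sinh (b * x)
    set q := Real.cosh (b * x)
    have h3 : 1 + (S / C / (p / q)) ^ 2 = (p ^ 2 + S ^ 2) / (C ^ 2 * p ^ 2) := by
      field_simp
      rw [e2]
      linear_combination p ^ 2 * e1
    rw [h3]
    field_simp
    ring
  · refine ContinuousOn.intervalIntegrable ?_
    rw [Set.uIcc_of_le ha0]
    refine ((continuousOn_tan_mul hb ha).mono
      (Set.Icc_subset_Icc_left (by linarith))).mul (Continuous.continuousOn ?_)
    exact continuous_const.mul (Continuous.div (by fun_prop) (by fun_prop) fun s => (hden s).ne')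

lemma tendsto_sum_integral_gap {b x a : ℝ} (hb : 0 < b) (hx : 0 < x) (ha0 : 0 ≤ a)
    (ha : b * a < π / 2) :
    Tendsto (fun N : ℕ => (∫ t in (0 : ℝ)..a, Real.tan (b * t) * t / (x ^ 2 + t ^ 2)) +
      ∑ k ∈ Finset.range N, ∫ t in ((k + 1) * π / b - a)..((k + 1) * π / b + a),
        Real.tan (b * t) * t / (x ^ 2 + t ^ 2)) atTop
      (nhds (b * a - Real.tanh (b * x) *
        Real.arctan (Real.tan (b * a) / Real.tanh (b * x)))) := by
  have htanc := (continuousOn_tan_mul hb ha).mono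
    (Set.Icc_subset_Icc_left (by linarith : -a ≤ 0))
  have hcontg := continuous_div_sq_add_sq hx
  obtain ⟨M, hM⟩ := isCompact_Icc.exists_bound_of_continuousOn htanc
  have hM0 : 0 ≤ M := (norm_nonneg _).trans (hM 0 ⟨le_rfl, ha0⟩)
  have hsh : 0 < Real.sinh (b * x) := Real.sinh_pos_iff.2 (by positivity)
  have hsum : Summable fun k : ℕ => 8 * a / (((k : ℝ) + 1) * π / b) ^ 2 := by
    have := ((summable_nat_add_iff 1).2 (Real.summable_one_div_nat_pow.2 one_lt_two)).mul_left
      (8 * a * b ^ 2 / π ^ 2)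
    refine this.congr fun k => ?_
    push_cast
    field_simp
  have hpair : ∀ s ∈ Set.Ioc 0 a, ∀ k : ℕ,
      ‖(s - (k + 1) * π / b) / (x ^ 2 + (s - (k + 1) * π / b) ^ 2) +
        (s + (k + 1) * π / b) / (x ^ 2 + (s + (k + 1) * π / b) ^ 2)‖ ≤
      8 * a / (((k : ℝ) + 1) * π / b) ^ 2 := fun s hs k => by
    have hc : 2 * a ≤ ((k : ℝ) + 1) * π / b := by
      rw [le_div_iff₀ hb]
      nlinarith [pi_pos, (Nat.cast_nonneg k : (0 : ℝ) ≤ k)]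
    refine (abs_div_sq_add_sq_pair_le hx hs.1.le (by linarith [hs.2]) (by positivity)).trans ?_
    have := hs.2
    gcongr
  have key := intervalIntegral.hasSum_integral_of_dominated_convergence (μ := volume)
    (a := 0) (b := a)
    (F := fun (k : ℕ) (s : ℝ) => Real.tan (b * s) *
        ((s - (k + 1) * π / b) / (x ^ 2 + (s - (k + 1) * π / b) ^ 2) +
          (s + (k + 1) * π / b) / (x ^ 2 + (s + (k + 1) * π / b) ^ 2)))
    (f := fun s => Real.tan (b * s) * (b * (Real.sin (b * s) * Real.cos (b * s) /
        (Real.sinh (b * x) ^ 2 + Real.sin (b * s) ^ 2)) - s / (x ^ 2 + s ^ 2)))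
    (fun k _ => M * (8 * a / (((k : ℝ) + 1) * π / b) ^ 2)) ?_ ?_ ?_ ?_ ?_
  · have hi1 : IntervalIntegrable (fun s => Real.tan (b * s) * (s / (x ^ 2 + s ^ 2)))
        volume 0 a := by
      refine ContinuousOn.intervalIntegrable ?_
      rw [Set.uIcc_of_le ha0]
      exact htanc.mul (by simpa using (hcontg 0).continuousOn)
    have hi2 : IntervalIntegrable (fun s => Real.tan (b * s) * (b * (Real.sin (b * s) *
        Real.cos (b * s) / (Real.sinh (b * x) ^ 2 + Real.sin (b * s) ^ 2)))) volume 0 a := by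
      refine ContinuousOn.intervalIntegrable ?_
      rw [Set.uIcc_of_le ha0]
      exact htanc.mul (continuous_const.mul (Continuous.div (by fun_prop) (by fun_prop)
        fun s => by positivity)).continuousOn
    rw [← integral_limit_kernel hb hx ha0 ha]
    simp only [mul_sub] at key
    rw [intervalIntegral.integral_sub hi2 hi1] at key
    have h := key.tendsto_sum_nat.const_add
      (∫ s in (0 : ℝ)..a, Real.tan (b * s) * (s / (x ^ 2 + s ^ 2)))
    rw [add_sub_cancel] at h
    simp only [integral_gap hb hx ha0 ha]
    simpa only [mul_div_assoc] using h
  · intro k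
    rw [Set.uIoc_of_le ha0]
    refine ContinuousOn.aestronglyMeasurable ?_ measurableSet_Ioc
    refine (htanc.mono Set.Ioc_subset_Icc_self).mul (Continuous.continuousOn ?_)
    simp only [sub_eq_add_neg]
    exact (hcontg _).add (hcontg _)
  · intro k
    refine Eventually.of_forall fun s hs => ?_
    rw [Set.uIoc_of_le ha0] at hs
    rw [norm_mul]
    exact mul_le_mul (hM s (Set.Ioc_subset_Icc_self hs)) (hpair s hs k) (norm_nonneg _) hM0
  · exact Eventually.of_forall fun _ _ => hsum.mul_left M
  · exact intervalIntegrable_const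
  · refine Eventually.of_forall fun s hs => ?_
    rw [Set.uIoc_of_le ha0] at hs
    refine HasSum.mul_left _ ?_
    exact (Summable.of_norm_bounded hsum (hpair s hs)).hasSum_iff_tendsto_nat.2
      (tendsto_sum_div_sq_add_sq hb hx s)

theorem pv_tan (b x : ℝ) (hb : 0 < b) (hx : 0 < x) :
    IsPVIntegral (fun t => Real.tan (b * t) * t / (x ^ 2 + t ^ 2)) (fun k => (2 * (k : ℝ) + 1) * Real.pi / (2 * b)) (Real.pi / (Real.exp (2 * b * x) + 1)) := by
  have hsh : 0 < Real.sinh (b * x) := Real.sinh_pos_iff.2 (by positivity)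
  have hT : 0 < Real.tanh (b * x) := by
    rw [Real.tanh_eq_sinh_div_cosh]; exact div_pos hsh (Real.cosh_pos _)
  refine ⟨π / (2 * b), by positivity, fun ε => b * (π / (2 * b) - ε) - Real.tanh (b * x) *
    Real.arctan (Real.tan (b * (π / (2 * b) - ε)) / Real.tanh (b * x)), fun ε hε => ?_, ?_⟩
  · have ha : b * (π / (2 * b) - ε) < π / 2 := by
      rw [mul_sub, show b * (π / (2 * b)) = π / 2 by field_simp]
      nlinarith [hε.1]
    convert tendsto_sum_integral_gap hb hx (sub_nonneg.2 hε.2.le) ha using 3 with N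
    · congr 1
      simp
    · refine Finset.sum_congr rfl fun k _ => ?_
      congr 1
      · field_simp; ring
      · push_cast; field_simp; ring
  · have hlin : Tendsto (fun ε => b * (π / (2 * b) - ε)) (nhdsWithin 0 (Set.Ioi 0))
        (nhdsWithin (π / 2) (Set.Iio (π / 2))) := by
      have hval : ∀ ε, b * (π / (2 * b) - ε) = π / 2 - b * ε := fun ε => by field_simp
      simp only [hval]
      refine tendsto_nhdsWithin_iff.2 ⟨?_, ?_⟩
      · refine Tendsto.mono_left ?_ nhdsWithin_le_nhds
        have : Continuous fun ε : ℝ => π / 2 - b * ε := by fun_prop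
        simpa using this.tendsto 0
      · filter_upwards [self_mem_nhdsWithin] with ε hε
        exact sub_lt_self _ (mul_pos hb hε)
    have harc := (tendsto_nhdsWithin_iff.1 Real.tendsto_arctan_atTop).1.comp
      ((Real.tendsto_tan_pi_div_two.comp hlin).atTop_div_const hT)
    have h := (hlin.mono_right nhdsWithin_le_nhds).sub (harc.const_mul (Real.tanh (b * x)))
    convert! h using 2
    rw [Real.tanh_eq, show 2 * b * x = b * x + b * x by ring, Real.exp_add, Real.exp_neg]
    have := Real.exp_pos (b * x)
    field_simp
    ring
end
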